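/- arXiv:1402.3444 — 6 statements merged into one kernel-verified Lean document; each statement's English description precedes it below -/
import Mathlib

section
/- Let G = (V,E) be a finite simple graph with m edges whose maximum vertex degree is at most √(m·M), let t ≥ 1 be an integer, and let c, M be positive integers with m = c²·M and M ≥ 2t². Let ξ : V → {1,…,c} be a random coloring that is 2t-wise independent and uniform. Then the expected value of X_t satisfies E[X_t] ≤ (2t)^{t−1} · m · M^{t−1}. -/
open MeasureTheory

/-- `sameColorTupleCount G t ξ` is the number of ordered `t`-tuples of pairwise distinct edges
of `G` such that all `t` edges receive the same unordered pair of endpoint colors under the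
coloring `ξ`. -/
noncomputable def sameColorTupleCount {V : Type*} (G : SimpleGraph V) {c : ℕ}
    (t : ℕ) (ξ : V → Fin c) : ℕ :=
  Nat.card {e : Fin t → ↥G.edgeSet // Function.Injective e ∧
    ∀ i j : Fin t, Sym2.map ξ (e i : Sym2 V) = Sym2.map ξ (e j : Sym2 V)}

open Finset in
/-- If `P` does not depend on the value at `v`, then at most a `1/c` fraction of the colorings
satisfying `P` give `s(u, v)` a prescribed pair of colors. -/
theorem card_mul_card_filter_sym2_eq_le {V : Type*} [Fintype V] [DecidableEq V] {c : ℕ}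
    (P : (V → Fin c) → Prop) [DecidablePred P] {u v x y : V}
    (huv : u ≠ v) (hxv : x ≠ v) (hyv : y ≠ v)
    (hP : ∀ g g' : V → Fin c, (∀ w, w ≠ v → g w = g' w) → P g → P g') :
    c * #{g : V → Fin c | P g ∧ s(g u, g v) = s(g x, g y)} ≤ #{g : V → Fin c | P g} := by
  have hcard : c * #{g : V → Fin c | P g ∧ s(g u, g v) = s(g x, g y)} =
      #((univ : Finset (Fin c)) ×ˢ
        ({g : V → Fin c | P g ∧ s(g u, g v) = s(g x, g y)} : Finset (V → Fin c))) := by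
    simp
  rw [hcard]
  refine card_le_card_of_injOn (fun p => Function.update p.2 v p.1) ?_ ?_
  · rintro ⟨τ, g⟩ h
    simp only [coe_product, coe_univ, coe_filter, mem_univ, true_and, Set.mem_prod, Set.mem_univ,
      Set.mem_ofPred_eq] at h ⊢
    exact hP g _ (fun w hw => (Function.update_of_ne hw _ _).symm) h.1
  · rintro ⟨τ, g⟩ h ⟨τ', g'⟩ h' heq
    simp only [coe_product, coe_univ, coe_filter, mem_univ, true_and, Set.mem_prod, Set.mem_univ,
      Set.mem_ofPred_eq] at h h' heq
    have hoff : ∀ w, w ≠ v → g w = g' w := fun w hw => by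
      simpa [Function.update_of_ne hw] using congrFun heq w
    have hτ : τ = τ' := by simpa using congrFun heq v
    have hv : g v = g' v := by
      have := h.2
      rw [hoff x hxv, hoff y hyv, ← h'.2, hoff u huv] at this
      exact Sym2.congr_right.1 this
    refine Prod.ext hτ (funext fun w => ?_)
    by_cases hw : w = v
    · rw [hw]; exact hv
    · exact hoff w hw

open Finset in
/-- If `P` does not depend on the values at `u` and `v`, then at most a `2/c²` fraction of the
colorings satisfying `P` give `s(u, v)` a prescribed pair of colors. -/
theorem sq_mul_card_filter_sym2_eq_le {V : Type*} [Fintype V] [DecidableEq V] {c : ℕ}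
    (P : (V → Fin c) → Prop) [DecidablePred P] {u v x y : V} (huv : u ≠ v)
    (hxu : x ≠ u) (hyu : y ≠ u) (hxv : x ≠ v) (hyv : y ≠ v)
    (hP : ∀ g g' : V → Fin c, (∀ w, w ≠ u → w ≠ v → g w = g' w) → P g → P g') :
    c ^ 2 * #{g : V → Fin c | P g ∧ s(g u, g v) = s(g x, g y)} ≤
      2 * #{g : V → Fin c | P g} := by
  have hcard : c ^ 2 * #{g : V → Fin c | P g ∧ s(g u, g v) = s(g x, g y)} =
      #((univ : Finset (Fin c × Fin c)) ×ˢ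
        ({g : V → Fin c | P g ∧ s(g u, g v) = s(g x, g y)} : Finset (V → Fin c))) := by
    simp [sq]
  have hcard' : 2 * #{g : V → Fin c | P g} =
      #((univ : Finset Bool) ×ˢ ({g : V → Fin c | P g} : Finset (V → Fin c))) := by
    simp
  rw [hcard, hcard']
  refine card_le_card_of_injOn (fun p => (decide (p.2 u = p.2 x),
    Function.update (Function.update p.2 v p.1.2) u p.1.1)) ?_ ?_
  · rintro ⟨τ, g⟩ h
    simp only [coe_product, coe_univ, coe_filter, mem_univ, true_and, Set.mem_prod, Set.mem_univ,
      Set.mem_ofPred_eq] at h ⊢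
    exact hP g _ (fun w hu hv => by simp [Function.update_of_ne hu, Function.update_of_ne hv]) h.1
  · rintro ⟨⟨τ, σ⟩, g⟩ h ⟨⟨τ', σ'⟩, g'⟩ h' heq
    simp only [coe_product, coe_univ, coe_filter, mem_univ, true_and, Set.mem_prod, Set.mem_univ,
      Set.mem_ofPred_eq, Prod.mk.injEq, decide_eq_decide] at h h' heq
    obtain ⟨hbit, heq⟩ := heq
    have hoff : ∀ w, w ≠ u → w ≠ v → g w = g' w := fun w hu hv => by
      simpa [Function.update_of_ne hu, Function.update_of_ne hv] using congrFun heq w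
    have hτ : τ = τ' := by simpa using congrFun heq u
    have hσ : σ = σ' := by simpa [Function.update_of_ne huv.symm] using congrFun heq v
    have hx := hoff x hxu hxv
    have hy := hoff y hyu hyv
    have h1 := h.2
    have h2 := h'.2
    rw [hx, hy] at h1
    rw [hx] at hbit
    rw [Sym2.eq_iff] at h1 h2
    have huv' : g u = g' u ∧ g v = g' v := by grind
    refine Prod.ext (Prod.ext hτ hσ) (funext fun w => ?_)
    by_cases hw : w = u
    · rw [hw]; exact huv'.1
    · by_cases hw' : w = v
      · rw [hw']; exact huv'.2
      · exact hoff w hw hw'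

/-- The set of endpoints of a tuple of unordered pairs. -/
def tupleSupport {V : Type*} [DecidableEq V] {j : ℕ} (e : Fin j → Sym2 V) : Finset V :=
  Finset.univ.biUnion fun i => (e i).toFinset

theorem mem_tupleSupport {V : Type*} [DecidableEq V] {j : ℕ} {e : Fin j → Sym2 V} {v : V} :
    v ∈ tupleSupport e ↔ ∃ i, v ∈ e i := by
  simp [tupleSupport]

theorem card_tupleSupport_le {V : Type*} [DecidableEq V] {j : ℕ} (e : Fin j → Sym2 V) :
    (tupleSupport e).card ≤ 2 * j := by
  refine (Finset.card_biUnion_le_card_mul _ _ 2 fun i _ => ?_).trans (by simp [mul_comm])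
  rw [Sym2.card_toFinset]
  split_ifs <;> simp

/-- All pairs in the tuple `e` receive the same unordered pair of colors. -/
def IsMonochromatic {V : Type*} {c j : ℕ} (g : V → Fin c) (e : Fin j → Sym2 V) : Prop :=
  ∀ i k, Sym2.map g (e i) = Sym2.map g (e k)

instance {V : Type*} {c j : ℕ} (g : V → Fin c) (e : Fin j → Sym2 V) :
    Decidable (IsMonochromatic g e) := by
  unfold IsMonochromatic; infer_instance

theorem IsMonochromatic.congr {V : Type*} [DecidableEq V] {c j : ℕ} {g g' : V → Fin c}
    {e : Fin j → Sym2 V} (h : IsMonochromatic g e) (hg : ∀ v ∈ tupleSupport e, g v = g' v) :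
    IsMonochromatic g' e := by
  have key : ∀ i, Sym2.map g (e i) = Sym2.map g' (e i) := fun i =>
    Sym2.map_congr fun v hv => hg v (mem_tupleSupport.2 ⟨i, hv⟩)
  intro i k
  rw [← key, ← key]
  exact h i k

theorem isMonochromatic_cons {V : Type*} {c j : ℕ} (g : V → Fin c) (a : Sym2 V)
    (e : Fin (j + 1) → Sym2 V) :
    IsMonochromatic g (Fin.cons a e : Fin (j + 2) → Sym2 V) ↔
      IsMonochromatic g e ∧ Sym2.map g a = Sym2.map g (e 0) := by
  constructor
  · intro h
    exact ⟨fun i k => by simpa using h i.succ k.succ, by simpa using h 0 (Fin.succ 0)⟩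
  · rintro ⟨h, ha⟩
    have key : ∀ i, Sym2.map g ((Fin.cons a e : Fin (j + 2) → Sym2 V) i) = Sym2.map g (e 0) := by
      intro i
      refine Fin.cases ?_ (fun i => ?_) i
      · simpa using ha
      · simpa using h i 0
    intro i k
    rw [key, key]

open Finset in
theorem sq_mul_card_isMonochromatic_cons_le {V : Type*} [Fintype V] [DecidableEq V] {c j : ℕ}
    (e : Fin (j + 1) → Sym2 V) (a : Sym2 V) (ha : ¬ a.IsDiag) :
    c ^ 2 * #{g : V → Fin c | IsMonochromatic g (Fin.cons a e : Fin (j + 2) → Sym2 V)} ≤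
      (2 + c * #{v ∈ tupleSupport e | v ∈ a} +
        if ∀ v ∈ a, v ∈ tupleSupport e then c ^ 2 else 0) *
        #{g : V → Fin c | IsMonochromatic g e} := by
  simp only [isMonochromatic_cons]
  induction a with | _ u v =>
  rw [Sym2.mk_isDiag_iff] at ha
  obtain ⟨x, y, hxy⟩ : ∃ x y, e 0 = s(x, y) := by
    induction h : e 0 with | _ x y => exact ⟨x, y, rfl⟩
  have hx : x ∈ tupleSupport e := mem_tupleSupport.2 ⟨0, by simp [hxy]⟩
  have hy : y ∈ tupleSupport e := mem_tupleSupport.2 ⟨0, by simp [hxy]⟩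
  simp only [hxy, Sym2.map_mk]
  have one : ∀ u v : V, u ∈ tupleSupport e → v ∉ tupleSupport e →
      c ^ 2 * #{g : V → Fin c | IsMonochromatic g e ∧ s(g u, g v) = s(g x, g y)} ≤
      c * #{v' ∈ tupleSupport e | v' ∈ s(u, v)} * #{g : V → Fin c | IsMonochromatic g e} := by
    intro u v hu hv
    have h1 := card_mul_card_filter_sym2_eq_le (fun g : V → Fin c => IsMonochromatic g e)
      (u := u) (v := v) (x := x) (y := y) (by grind) (by grind) (by grind)
      (fun g g' h hg => hg.congr fun w hw => h w (by grind))
    have h2 : 1 ≤ #{v' ∈ tupleSupport e | v' ∈ s(u, v)} :=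
      card_pos.2 ⟨u, by simp [hu]⟩
    calc _ = c * 1 * (c * #{g : V → Fin c | IsMonochromatic g e ∧ s(g u, g v) = s(g x, g y)}) := by
          ring
      _ ≤ _ := by gcongr
  by_cases hu : u ∈ tupleSupport e <;> by_cases hv : v ∈ tupleSupport e
  · rw [if_pos (by simp [hu, hv])]
    have : #{g : V → Fin c | IsMonochromatic g e ∧ s(g u, g v) = s(g x, g y)} ≤
        #{g : V → Fin c | IsMonochromatic g e} :=
      card_le_card (monotone_filter_right _ fun g _ h => h.1)
    exact Nat.mul_le_mul (Nat.le_add_left _ _) this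
  · exact (one u v hu hv).trans (Nat.mul_le_mul_right _ (by omega))
  · have h := one v u hv hu
    have hswap : ∀ g : V → Fin c, s(g v, g u) = s(g u, g v) := fun _ => Sym2.eq_swap
    rw [Sym2.eq_swap (a := v)] at h
    simp only [hswap] at h
    exact h.trans (Nat.mul_le_mul_right _ (by omega))
  · have := sq_mul_card_filter_sym2_eq_le (fun g : V → Fin c => IsMonochromatic g e)
      (u := u) (v := v) (x := x) (y := y) ha (by grind) (by grind) (by grind) (by grind)
      (fun g g' h hg => hg.congr fun w hw => h w (by grind) (by grind))
    exact this.trans (Nat.mul_le_mul_right _ (by omega))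

open Finset in
/-- The number of further edges spanned by the endpoints of `j` distinct edges. -/
theorem card_edges_within_tupleSupport_le {V : Type*} [Fintype V] [DecidableEq V]
    (G : SimpleGraph V) [DecidableRel G.Adj] {j : ℕ} (e : Fin j → Sym2 V)
    (he : Function.Injective e) (heG : ∀ i, e i ∈ G.edgeFinset) :
    #{a ∈ G.edgeFinset | (∀ i, e i ≠ a) ∧ ∀ v ∈ a, v ∈ tupleSupport e} ≤
      2 * j ^ 2 - 2 * j := by
  have hdisj : Disjoint
      ({a ∈ G.edgeFinset | (∀ i, e i ≠ a) ∧ ∀ v ∈ a, v ∈ tupleSupport e} : Finset (Sym2 V))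
      (univ.image e) := by
    rw [Finset.disjoint_left]
    intro a ha ha'
    simp only [mem_filter, mem_image, mem_univ, true_and] at ha ha'
    obtain ⟨i, hi⟩ := ha'
    exact ha.2.1 i hi
  have hsub : ({a ∈ G.edgeFinset | (∀ i, e i ≠ a) ∧ ∀ v ∈ a, v ∈ tupleSupport e} :
      Finset (Sym2 V)) ∪ univ.image e ⊆
      (tupleSupport e).offDiag.image Sym2.mk.uncurry := by
    have key : ∀ a ∈ G.edgeFinset, (∀ v ∈ a, v ∈ tupleSupport e) →
        a ∈ (tupleSupport e).offDiag.image Sym2.mk.uncurry := by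
      intro a ha h
      induction a with | _ u v =>
      simp only [SimpleGraph.mem_edgeFinset, SimpleGraph.mem_edgeSet] at ha
      exact mem_image.2 ⟨(u, v), by simp [h u (by simp), h v (by simp), ha.ne], rfl⟩
    refine union_subset (fun a ha => ?_) (fun a ha => ?_)
    · rw [mem_filter] at ha
      exact key a ha.1 ha.2.2
    · obtain ⟨i, -, rfl⟩ := mem_image.1 ha
      exact key _ (heG i) fun v hv => mem_tupleSupport.2 ⟨i, hv⟩
  have h1 := card_le_card hsub
  rw [card_union_of_disjoint hdisj, card_image_of_injective _ he, Sym2.card_image_offDiag,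
    card_univ, Fintype.card_fin] at h1
  have h2 : (#(tupleSupport e)).choose 2 ≤ (2 * j).choose 2 :=
    Nat.choose_le_choose 2 (card_tupleSupport_le e)
  have h3 : (2 * j).choose 2 = 2 * j ^ 2 - j := by
    rw [Nat.choose_two_right, mul_assoc, Nat.mul_div_cancel_left _ two_pos, Nat.mul_sub]
    ring_nf
  have : j ≤ j ^ 2 := Nat.le_self_pow two_ne_zero j
  omega

open Finset in
/-- The number of pairs of a tuple of `j` distinct edges and a coloring making it
monochromatic. -/
def monochromaticCount {V : Type*} [Fintype V] [DecidableEq V]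
    (G : SimpleGraph V) [DecidableRel G.Adj] (c j : ℕ) : ℕ :=
  ∑ e : Fin j → G.edgeSet with Function.Injective e,
    #{g : V → Fin c | IsMonochromatic g fun i => (e i : Sym2 V)}

open Finset in
theorem sum_card_isMonochromatic_cons_le {V : Type*} [Fintype V] [DecidableEq V]
    (G : SimpleGraph V) [DecidableRel G.Adj] {c M j : ℕ} (hc : 0 < c)
    (hm : #G.edgeFinset = c ^ 2 * M) (hdeg : ∀ v, G.degree v ≤ c * M)
    (e : Fin (j + 1) → Sym2 V) (he : Function.Injective e) (heG : ∀ i, e i ∈ G.edgeFinset) :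
    ∑ a ∈ G.edgeFinset with ∀ i, e i ≠ a,
      #{g : V → Fin c | IsMonochromatic g (Fin.cons a e : Fin (j + 2) → Sym2 V)} ≤
    (2 * (j + 2) * M + (2 * (j + 1) ^ 2 - 2 * (j + 1))) *
      #{g : V → Fin c | IsMonochromatic g e} := by
  refine Nat.le_of_mul_le_mul_left (c := c ^ 2) ?_ (by positivity)
  rw [mul_sum, ← mul_assoc]
  have hterm : ∀ a ∈ ({a ∈ G.edgeFinset | ∀ i, e i ≠ a} : Finset (Sym2 V)), _ := fun a ha =>
    sq_mul_card_isMonochromatic_cons_le (c := c) e a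
      (G.not_isDiag_of_mem_edgeFinset (mem_filter.1 ha).1)
  refine (sum_le_sum hterm).trans ?_
  rw [← sum_mul]
  refine Nat.mul_le_mul_right _ ?_
  rw [sum_add_distrib, sum_add_distrib, ← mul_sum, ← sum_filter, filter_filter, sum_const,
    sum_const, smul_eq_mul, smul_eq_mul]
  have h1 : #{a ∈ G.edgeFinset | ∀ i, e i ≠ a} ≤ c ^ 2 * M := hm ▸ card_filter_le _ _
  have h2 : ∑ a ∈ G.edgeFinset with ∀ i, e i ≠ a, #{v ∈ tupleSupport e | v ∈ a} ≤
      2 * (j + 1) * (c * M) := by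
    calc _ ≤ ∑ a ∈ G.edgeFinset, #{v ∈ tupleSupport e | v ∈ a} :=
          sum_le_sum_of_subset (filter_subset _ _)
      _ = ∑ v ∈ tupleSupport e, #{a ∈ G.edgeFinset | v ∈ a} :=
          sum_card_bipartiteAbove_eq_sum_card_bipartiteBelow (fun a v => v ∈ a)
      _ = ∑ v ∈ tupleSupport e, G.degree v := by
          refine sum_congr rfl fun v _ => ?_
          rw [← G.card_incidenceFinset_eq_degree, G.incidenceFinset_eq_filter]
      _ ≤ ∑ v ∈ tupleSupport e, c * M := sum_le_sum fun v _ => hdeg v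
      _ ≤ _ := by
          rw [sum_const, smul_eq_mul]
          exact Nat.mul_le_mul_right _ (card_tupleSupport_le e)
  have h3 := card_edges_within_tupleSupport_le G e he heG
  calc _ ≤ c ^ 2 * M * 2 + c * (2 * (j + 1) * (c * M)) +
        (2 * (j + 1) ^ 2 - 2 * (j + 1)) * c ^ 2 := by gcongr
    _ = _ := by ring

open Finset in
theorem monochromaticCount_succ_le {V : Type*} [Fintype V] [DecidableEq V]
    (G : SimpleGraph V) [DecidableRel G.Adj] {c M j : ℕ} (hc : 0 < c)
    (hm : #G.edgeFinset = c ^ 2 * M) (hdeg : ∀ v, G.degree v ≤ c * M) :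
    monochromaticCount G c (j + 2) ≤ (2 * (j + 2) * M + (2 * (j + 1) ^ 2 - 2 * (j + 1))) *
      monochromaticCount G c (j + 1) := by
  unfold monochromaticCount
  rw [mul_sum, sum_filter, ← (Fin.consEquiv fun _ : Fin (j + 2) => G.edgeSet).sum_comp,
    Fintype.sum_prod_type_right, sum_filter]
  refine sum_le_sum fun e _ => ?_
  split_ifs with he
  · refine le_trans (le_of_eq ?_) (sum_card_isMonochromatic_cons_le G hc hm hdeg
      (fun i => (e i : Sym2 V)) (Subtype.val_injective.comp he)
      (fun i => by simp))
    rw [sum_filter, ← sum_coe_sort G.edgeFinset]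
    refine Fintype.sum_equiv (Equiv.subtypeEquivRight fun a => by simp) _ _ fun a => ?_
    have hval : (fun i => ((Fin.cons a e : Fin (j + 2) → G.edgeSet) i : Sym2 V)) =
        Fin.cons (a : Sym2 V) (fun i => (e i : Sym2 V)) := by
      funext i
      refine Fin.cases ?_ (fun i => ?_) i <;> simp
    have hinj : Function.Injective (Fin.cons a e : Fin (j + 2) → G.edgeSet) ↔
        ∀ i, (e i : Sym2 V) ≠ a := by
      rw [Fin.cons_injective_iff]
      simp [he, Subtype.ext_iff]
    simp only [Fin.consEquiv, Equiv.coe_fn_mk, Equiv.subtypeEquivRight_apply_coe, hinj, hval]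
  · refine le_of_eq (sum_eq_zero fun a _ => if_neg fun h => he ?_)
    exact (Fin.cons_injective_iff.1 h).2

theorem two_mul_pow_mul_le (j : ℕ) {M : ℕ} (hM : 2 * (j + 1) ^ 2 ≤ M) :
    (2 * (j + 1)) ^ j * (2 * (j + 2) * M + (2 * (j + 1) ^ 2 - 2 * (j + 1))) ≤
      (2 * (j + 2)) ^ (j + 1) * M := by
  cases j with
  | zero => simp
  | succ j =>
    calc _ ≤ (2 * (j + 2)) ^ (j + 1) * (2 * (j + 3) * M + M) := by gcongr; omega
      _ = (2 * (j + 2)) ^ j * ((2 * (j + 2)) * (2 * (j + 3) + 1)) * M := by ring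
      _ ≤ (2 * (j + 3)) ^ j * (2 * (j + 3)) ^ 2 * M := by
          gcongr ?_ ^ _ * ?_ * _
          · omega
          · nlinarith
      _ = _ := by ring

open Finset in
theorem monochromaticCount_le {V : Type*} [Fintype V] [DecidableEq V]
    (G : SimpleGraph V) [DecidableRel G.Adj] {c M j : ℕ} (hc : 0 < c)
    (hm : #G.edgeFinset = c ^ 2 * M) (hdeg : ∀ v, G.degree v ≤ c * M)
    (hM : 2 * (j + 1) ^ 2 ≤ M) :
    monochromaticCount G c (j + 1) ≤
      (2 * (j + 1)) ^ j * #G.edgeFinset * M ^ j * c ^ Fintype.card V := by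
  induction j with
  | zero =>
    have h : ∀ e : Fin 1 → G.edgeSet,
        #{g : V → Fin c | IsMonochromatic g fun i => (e i : Sym2 V)} ≤ c ^ Fintype.card V :=
      fun e => (card_filter_le _ _).trans (by simp)
    refine (sum_le_card_nsmul _ _ _ fun e _ => h e).trans ?_
    rw [smul_eq_mul]
    simp only [zero_add, pow_zero, one_mul, mul_one]
    refine Nat.mul_le_mul_right _ ((card_filter_le _ _).trans (le_of_eq ?_))
    rw [card_univ, Fintype.card_fun, Fintype.card_fin, pow_one, ← SimpleGraph.edgeFinset_card]
  | succ j ih =>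
    have hM' : 2 * (j + 1) ^ 2 ≤ M := le_trans (by gcongr; omega) hM
    calc _ ≤ _ := monochromaticCount_succ_le G hc hm hdeg
      _ ≤ (2 * (j + 2) * M + (2 * (j + 1) ^ 2 - 2 * (j + 1))) *
          ((2 * (j + 1)) ^ j * #G.edgeFinset * M ^ j * c ^ Fintype.card V) := by
          gcongr; exact ih hM'
      _ = ((2 * (j + 1)) ^ j * (2 * (j + 2) * M + (2 * (j + 1) ^ 2 - 2 * (j + 1)))) *
          (#G.edgeFinset * M ^ j * c ^ Fintype.card V) := by ring
      _ ≤ ((2 * (j + 2)) ^ (j + 1) * M) *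
          (#G.edgeFinset * M ^ j * c ^ Fintype.card V) := by
          gcongr ?_ * _; exact two_mul_pow_mul_le j hM'
      _ = _ := by ring

open Finset in
theorem card_filter_eqOn {V : Type*} [Fintype V] [DecidableEq V] {c : ℕ} (W : Finset V)
    (h : V → Fin c) :
    #{g : V → Fin c | ∀ v ∈ W, g v = h v} = c ^ (Fintype.card V - #W) := by
  have : ({g : V → Fin c | ∀ v ∈ W, g v = h v} : Finset (V → Fin c)) =
      Fintype.piFinset fun v => if v ∈ W then {h v} else univ := by
    ext g
    simp only [mem_filter, mem_univ, true_and, Fintype.mem_piFinset]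
    refine forall_congr' fun v => ?_
    split_ifs with hv <;> simp [hv]
  rw [this, Fintype.card_piFinset, ← card_compl, ← prod_const, ← prod_compl_mul_prod W]
  rw [prod_congr rfl (g := fun _ => c), prod_congr (s₁ := W) rfl (g := fun _ => 1)]
  · simp
  · intro v hv; simp [hv]
  · intro v hv; simp [mem_compl.1 hv]

open Finset in
/-- A weight on colorings that is uniform on the colorings of `W` gives an event determined by
the colors on `W` its uniform probability. -/
theorem sum_filter_eq_card_div {V : Type*} [Fintype V] [DecidableEq V] {c : ℕ} (hc : 0 < c)
    (p : (V → Fin c) → ℝ) (W : Finset V)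
    (hp : ∀ h : V → Fin c, ∑ g with ∀ v ∈ W, g v = h v, p g = (1 / (c : ℝ)) ^ #W)
    (P : (V → Fin c) → Prop) [DecidablePred P]
    (hP : ∀ g g' : V → Fin c, (∀ v ∈ W, g v = g' v) → P g → P g') :
    ∑ g with P g, p g = #{g | P g} / (c : ℝ) ^ Fintype.card V := by
  have hc' : (c : ℝ) ≠ 0 := by positivity
  have key : ∑ h with P h, ∑ g with ∀ v ∈ W, g v = h v, p g =
      (c : ℝ) ^ (Fintype.card V - #W) * ∑ g with P g, p g := by
    rw [mul_sum]
    simp only [sum_filter (fun g => ∀ v ∈ W, _)]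
    simp only [sum_filter P]
    rw [← sum_filter, sum_comm]
    refine sum_congr rfl fun g _ => ?_
    rw [← sum_filter, filter_filter, sum_const, nsmul_eq_mul]
    split_ifs with hg
    · rw [← Nat.cast_pow, ← card_filter_eqOn W g]
      congr 3
      ext h
      simp only [mem_filter, mem_univ, true_and]
      exact ⟨fun hh v hv => (hh.2 v hv).symm, fun hh =>
        ⟨hP g h (fun v hv => (hh v hv).symm) hg, fun v hv => (hh v hv).symm⟩⟩
    · rw [filter_false_of_mem fun h _ hh => hg (hP h g (fun v hv => (hh.2 v hv).symm) hh.1)]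
      simp
  simp only [hp, sum_const, nsmul_eq_mul] at key
  have hW : (c : ℝ) ^ Fintype.card V = c ^ (Fintype.card V - #W) * c ^ #W := by
    rw [← pow_add, Nat.sub_add_cancel (card_le_univ W)]
  rw [one_div, inv_pow] at key
  rw [hW, eq_div_iff (by positivity), ← mul_assoc, mul_comm (∑ g with P g, p g), ← key]
  field_simp

open Finset in
theorem sameColorTupleCount_eq_card {V : Type*} [Fintype V] [DecidableEq V]
    (G : SimpleGraph V) [DecidableRel G.Adj] {c : ℕ} (t : ℕ) (g : V → Fin c) :
    sameColorTupleCount G t g = #{e : Fin t → G.edgeSet | Function.Injective e ∧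
      IsMonochromatic g fun i => (e i : Sym2 V)} := by
  rw [sameColorTupleCount, ← Fintype.card_subtype, ← Nat.card_eq_fintype_card]
  rfl

open Finset in
theorem sum_mul_sameColorTupleCount {V : Type*} [Fintype V] [DecidableEq V]
    (G : SimpleGraph V) [DecidableRel G.Adj] {c t : ℕ} (hc : 0 < c) (p : (V → Fin c) → ℝ)
    (hp : ∀ (W : Finset V) (h : V → Fin c), #W ≤ 2 * t →
      ∑ g with ∀ v ∈ W, g v = h v, p g = (1 / (c : ℝ)) ^ #W) :
    ∑ g, p g * sameColorTupleCount G t g =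
      monochromaticCount G c t / (c : ℝ) ^ Fintype.card V := by
  have hcount : ∀ g : V → Fin c, p g * sameColorTupleCount G t g =
      ∑ e : Fin t → G.edgeSet with Function.Injective e,
        if IsMonochromatic g fun i => (e i : Sym2 V) then p g else 0 := fun g => by
    rw [sameColorTupleCount_eq_card, ← sum_filter, filter_filter, sum_const, nsmul_eq_mul,
      mul_comm]
  simp only [hcount]
  rw [sum_comm, monochromaticCount, Nat.cast_sum, sum_div]
  refine sum_congr rfl fun e _ => ?_
  rw [← sum_filter]
  exact sum_filter_eq_card_div hc p _ (fun h => hp _ h (card_tupleSupport_le _)) _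
    fun g g' h hg => hg.congr h

/-- If `G` has `m = c²·M` edges, maximum degree at most `√(m·M)`, `M ≥ 2t²`, and
`ξ` is a `2t`-wise independent uniform random coloring with `c` colors, then
`E[X_t] ≤ (2t)^(t−1) · m · M^(t−1)`. -/
theorem expected_sameColorTupleCount_le {V : Type*} [Fintype V] [DecidableEq V]
    (G : SimpleGraph V) [DecidableRel G.Adj]
    {Ω : Type*} [MeasurableSpace Ω] (μ : Measure Ω) [IsProbabilityMeasure μ]
    (t c M : ℕ) (ht : 1 ≤ t) (hc : 0 < c) (hM : 0 < M)
    (hm : G.edgeFinset.card = c ^ 2 * M) (hMt : 2 * t ^ 2 ≤ M)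
    (hdeg : ∀ v : V, G.degree v ^ 2 ≤ G.edgeFinset.card * M)
    (ξ : Ω → V → Fin c)
    (hmeas : ∀ (v : V) (τ : Fin c), MeasurableSet {ω | ξ ω v = τ})
    (hindep : ∀ (W : Finset V) (g : V → Fin c), W.card ≤ 2 * t →
      μ {ω | ∀ v ∈ W, ξ ω v = g v} = (1 / (c : ENNReal)) ^ W.card) :
    ∫ ω, (sameColorTupleCount G t (ξ ω) : ℝ) ∂μ ≤
      (2 * t : ℝ) ^ (t - 1) * G.edgeFinset.card * (M : ℝ) ^ (t - 1) := by
  have hdeg' : ∀ v, G.degree v ≤ c * M := fun v => by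
    have h := hdeg v
    rw [hm, show c ^ 2 * M * M = (c * M) ^ 2 by ring] at h
    exact (Nat.pow_le_pow_iff_left two_ne_zero).1 h
  have hξ : Measurable ξ := measurable_pi_iff.2 fun v => measurable_to_countable' (hmeas v)
  have hprob := Measure.isProbabilityMeasure_map (μ := μ) hξ.aemeasurable
  have hp : ∀ (W : Finset V) (h : V → Fin c), W.card ≤ 2 * t →
      ∑ g with ∀ v ∈ W, g v = h v, (μ.map ξ).real {g} = (1 / (c : ℝ)) ^ W.card := by
    intro W h hW
    rw [sum_measureReal_singleton, map_measureReal_apply hξ (Set.toFinite _).measurableSet]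
    have hpre : ξ ⁻¹' ((Finset.univ.filter fun g : V → Fin c => ∀ v ∈ W, g v = h v :
        Finset (V → Fin c)) : Set (V → Fin c)) = {ω | ∀ v ∈ W, ξ ω v = h v} := by
      ext ω
      simp
    rw [hpre, Measure.real, hindep W h hW]
    simp
  have hint : ∫ ω, (sameColorTupleCount G t (ξ ω) : ℝ) ∂μ =
      ∑ g, (μ.map ξ).real {g} * sameColorTupleCount G t g := by
    rw [← integral_map (f := fun g => (sameColorTupleCount G t g : ℝ)) hξ.aemeasurable
      (Measurable.of_discrete).aestronglyMeasurable, integral_fintype (Integrable.of_finite)]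
    simp only [smul_eq_mul]
  obtain ⟨j, rfl⟩ : ∃ j, t = j + 1 := ⟨t - 1, by omega⟩
  rw [hint, sum_mul_sameColorTupleCount G hc _ hp, div_le_iff₀ (by positivity)]
  rw [Nat.add_sub_cancel]
  exact_mod_cast monochromaticCount_le G hc hm hdeg' hMt
end

section
/- There is a universal constant a > 0 with the following property. Let G = (V,E) be a finite simple graph with m edges in which every vertex has degree at most √m, and let c, M be positive integers with m = c²·M. Color the vertices of G independently and uniformly at random with colors from {1,…,c}. Then for every pair of colors τ1 ≤ τ2, Pr[ |E_{τ1,τ2}| ≥ 4M ] ≤ exp(−a·M/√m). -/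
open MeasureTheory

universe u v

/-- `colorPairEdgeCount G ξ τ1 τ2` is the number of edges of `G` whose endpoints receive the
unordered pair of colors `{τ1, τ2}` under the coloring `ξ` (the size of `E_{τ1,τ2}`). -/
noncomputable def colorPairEdgeCount {V : Type u} (G : SimpleGraph V) {c : ℕ}
    (ξ : V → Fin c) (τ1 τ2 : Fin c) : ℕ :=
  Nat.card {e : Sym2 V // e ∈ G.edgeSet ∧ Sym2.map ξ e = s(τ1, τ2)}

/-- The ordered pairs of adjacent vertices, both outside `W`, that `g` colors `(τ1, τ2)`. -/
def coloredDartsOutside {V : Type u} [Fintype V] [DecidableEq V] (G : SimpleGraph V)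
    [DecidableRel G.Adj] {c : ℕ} (τ1 τ2 : Fin c) (W : Finset V) (g : V → Fin c) :
    Finset (V × V) :=
  {p | (G.Adj p.1 p.2 ∧ p.1 ∉ W ∧ p.2 ∉ W) ∧ g p.1 = τ1 ∧ g p.2 = τ2}

/-- The number of sequences of `r` pairwise vertex-disjoint ordered pairs of adjacent vertices,
all avoiding `W`, that `g` colors `(τ1, τ2)`. -/
def coloredMatchingCount {V : Type u} [Fintype V] [DecidableEq V] (G : SimpleGraph V)
    [DecidableRel G.Adj] {c : ℕ} (τ1 τ2 : Fin c) : ℕ → Finset V → (V → Fin c) → ℕ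
  | 0, _, _ => 1
  | r + 1, W, g => ∑ p ∈ coloredDartsOutside G τ1 τ2 W g,
      coloredMatchingCount G τ1 τ2 r (insert p.1 (insert p.2 W)) g

theorem card_adj_pairs {V : Type u} [Fintype V] (G : SimpleGraph V) [DecidableRel G.Adj] :
    (Finset.univ.filter fun p : V × V => G.Adj p.1 p.2).card = 2 * G.edgeFinset.card := by
  rw [← G.sum_degrees_eq_twice_card_edges, Finset.card_filter, Fintype.sum_prod_type]
  refine Finset.sum_congr rfl fun x _ => ?_
  rw [← Finset.card_filter, ← G.card_neighborFinset_eq_degree, G.neighborFinset_eq_filter]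

section

variable {V : Type u} [Fintype V] [DecidableEq V] (G : SimpleGraph V) [DecidableRel G.Adj]
  {c : ℕ} (τ1 τ2 : Fin c)

theorem card_adj_pairs_fst_mem (W : Finset V) :
    (Finset.univ.filter fun p : V × V => G.Adj p.1 p.2 ∧ p.1 ∈ W).card =
      ∑ x ∈ W, G.degree x := by
  rw [Finset.card_filter, Fintype.sum_prod_type, ← Finset.sum_filter_add_sum_filter_not
    Finset.univ (· ∈ W)]
  have h : ∑ x ∈ Finset.univ.filter (· ∉ W), ∑ y, (if G.Adj x y ∧ x ∈ W then 1 else 0) = 0 := by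
    refine Finset.sum_eq_zero fun x hx => Finset.sum_eq_zero fun y _ => ?_
    simp_all
  rw [h, add_zero, Finset.filter_univ_mem]
  refine Finset.sum_congr rfl fun x hx => ?_
  rw [← Finset.card_filter, ← G.card_neighborFinset_eq_degree, G.neighborFinset_eq_filter]
  simp [hx]

theorem card_adj_pairs_snd_mem (W : Finset V) :
    (Finset.univ.filter fun p : V × V => G.Adj p.1 p.2 ∧ p.2 ∈ W).card =
      ∑ x ∈ W, G.degree x := by
  rw [← card_adj_pairs_fst_mem]
  refine Finset.card_bij (fun p _ => p.swap) ?_ ?_ ?_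
  · intro p hp
    simpa [G.adj_comm] using hp
  · intro p _ q _ h
    exact Prod.swap_injective h
  · intro p hp
    exact ⟨p.swap, by simpa [G.adj_comm] using hp, Prod.swap_swap p⟩

theorem colorPairEdgeCount_le_card (g : V → Fin c) :
    colorPairEdgeCount G g τ1 τ2 ≤ (coloredDartsOutside G τ1 τ2 ∅ g).card := by
  have h : {e : Sym2 V | e ∈ G.edgeSet ∧ Sym2.map g e = s(τ1, τ2)} ⊆
      ((coloredDartsOutside G τ1 τ2 ∅ g).image fun p => s(p.1, p.2) : Finset (Sym2 V)) := by
    intro e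
    induction e with
    | _ x y =>
      rintro ⟨hadj, hmap⟩
      rw [SimpleGraph.mem_edgeSet] at hadj
      rw [Sym2.map_mk, Sym2.eq_iff] at hmap
      rw [Finset.mem_coe, Finset.mem_image]
      rcases hmap with h | h
      · exact ⟨(x, y), by simp [coloredDartsOutside, hadj, h], rfl⟩
      · exact ⟨(y, x), by simp [coloredDartsOutside, hadj.symm, h], Sym2.eq_swap⟩
  calc colorPairEdgeCount G g τ1 τ2
      = {e : Sym2 V | e ∈ G.edgeSet ∧ Sym2.map g e = s(τ1, τ2)}.ncard := rfl
    _ ≤ _ := Set.ncard_le_ncard h (Finset.finite_toSet _)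
    _ ≤ _ := by rw [Set.ncard_coe_finset]; exact Finset.card_image_le

theorem card_coloredDartsOutside_empty_le (W : Finset V) (g : V → Fin c) :
    (coloredDartsOutside G τ1 τ2 ∅ g).card ≤
      (coloredDartsOutside G τ1 τ2 W g).card + 2 * ∑ x ∈ W, G.degree x := by
  have h : coloredDartsOutside G τ1 τ2 ∅ g ⊆ coloredDartsOutside G τ1 τ2 W g ∪
      ((Finset.univ.filter fun p : V × V => G.Adj p.1 p.2 ∧ p.1 ∈ W) ∪
        Finset.univ.filter fun p : V × V => G.Adj p.1 p.2 ∧ p.2 ∈ W) := by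
    intro p
    simp only [coloredDartsOutside, Finset.mem_union, Finset.mem_filter, Finset.mem_univ,
      true_and, Finset.notMem_empty, not_false_eq_true, and_true]
    tauto
  have h₁ := Finset.card_le_card h
  have h₂ := Finset.card_union_le (coloredDartsOutside G τ1 τ2 W g)
    ((Finset.univ.filter fun p : V × V => G.Adj p.1 p.2 ∧ p.1 ∈ W) ∪
        Finset.univ.filter fun p : V × V => G.Adj p.1 p.2 ∧ p.2 ∈ W)
  have h₃ := Finset.card_union_le (Finset.univ.filter fun p : V × V => G.Adj p.1 p.2 ∧ p.1 ∈ W)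
    (Finset.univ.filter fun p : V × V => G.Adj p.1 p.2 ∧ p.2 ∈ W)
  rw [card_adj_pairs_fst_mem, card_adj_pairs_snd_mem] at h₃
  omega

theorem pow_le_coloredMatchingCount {M : ℕ} {D : ℝ} (hdeg : ∀ v, (G.degree v : ℝ) ≤ D)
    (hD : 0 ≤ D) {g : V → Fin c} (hg : 4 * M ≤ (coloredDartsOutside G τ1 τ2 ∅ g).card) (r : ℕ) :
    ∀ W : Finset V, 2 * (W.card + 2 * r) * D ≤ M + 4 * D →
      (3 * M) ^ r ≤ coloredMatchingCount G τ1 τ2 r W g := by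
  induction r with
  | zero => intro W _; simp [coloredMatchingCount]
  | succ r ih =>
    intro W hW
    push_cast at hW
    have hsum : ((∑ x ∈ W, G.degree x : ℕ) : ℝ) ≤ W.card * D := by
      push_cast
      simpa using Finset.sum_le_sum fun x (_ : x ∈ W) => hdeg x
    have hrD : 0 ≤ (r : ℝ) * D := by positivity
    have hblocked : 2 * ∑ x ∈ W, G.degree x ≤ M := by
      have : 2 * ((∑ x ∈ W, G.degree x : ℕ) : ℝ) ≤ M := by nlinarith
      exact_mod_cast this
    have hfree : 3 * M ≤ (coloredDartsOutside G τ1 τ2 W g).card := by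
      have := card_coloredDartsOutside_empty_le G τ1 τ2 W g
      omega
    rw [coloredMatchingCount, pow_succ']
    refine (Nat.mul_le_mul_right _ hfree).trans ?_
    rw [← smul_eq_mul]
    refine Finset.card_nsmul_le_sum _ _ _ fun p _ => ih _ ?_
    have hcard : ((insert p.1 (insert p.2 W)).card : ℝ) ≤ W.card + 2 := by
      have h₁ := Finset.card_insert_le p.1 (insert p.2 W)
      have h₂ := Finset.card_insert_le p.2 W
      exact_mod_cast (by omega : (insert p.1 (insert p.2 W)).card ≤ W.card + 2)
    nlinarith [mul_le_mul_of_nonneg_right hcard hD]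

theorem card_extensions_mul_pow (W : Finset V) (h : V → Fin c) :
    (Finset.univ.filter fun g : V → Fin c => ∀ v ∈ W, g v = h v).card * c ^ W.card =
      c ^ Fintype.card V := by
  have heq : (Finset.univ.filter fun g : V → Fin c => ∀ v ∈ W, g v = h v) =
      Fintype.piFinset fun v => if v ∈ W then {h v} else Finset.univ := by
    ext g
    simp only [Finset.mem_filter, Finset.mem_univ, true_and, Fintype.mem_piFinset]
    refine forall_congr' fun v => ?_
    by_cases hv : v ∈ W <;> simp [hv]
  have hcard : ∀ v, (if v ∈ W then {h v} else Finset.univ : Finset (Fin c)).card =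
      if v ∈ W then 1 else c := by
    intro v
    split_ifs <;> simp
  have hW : c ^ W.card = ∏ v, if v ∈ W then c else 1 := by
    rw [Finset.prod_ite_mem, Finset.univ_inter, Finset.prod_const]
  rw [heq, Fintype.card_piFinset, hW, ← Finset.prod_mul_distrib]
  rw [Finset.prod_congr rfl (g := fun _ => c) fun v _ => by rw [hcard]; split_ifs <;> simp]
  simp

theorem sum_coloredMatchingCount_le (r : ℕ) : ∀ (W : Finset V) (h : V → Fin c),
    (∑ g ∈ Finset.univ.filter (fun g : V → Fin c => ∀ v ∈ W, g v = h v),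
      coloredMatchingCount G τ1 τ2 r W g) * c ^ (W.card + 2 * r) ≤
      (2 * G.edgeFinset.card) ^ r * c ^ Fintype.card V := by
  induction r with
  | zero =>
    intro W h
    simpa [coloredMatchingCount] using (card_extensions_mul_pow W h).le
  | succ r ih =>
    intro W h
    have hswap : ∑ g ∈ Finset.univ.filter (fun g : V → Fin c => ∀ v ∈ W, g v = h v),
        coloredMatchingCount G τ1 τ2 (r + 1) W g =
        ∑ p ∈ Finset.univ.filter (fun p : V × V => G.Adj p.1 p.2 ∧ p.1 ∉ W ∧ p.2 ∉ W),
          ∑ g ∈ Finset.univ.filter (fun g : V → Fin c =>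
            ∀ v ∈ insert p.1 (insert p.2 W),
              g v = Function.update (Function.update h p.1 τ1) p.2 τ2 v),
            coloredMatchingCount G τ1 τ2 r (insert p.1 (insert p.2 W)) g := by
      simp only [coloredMatchingCount]
      refine Finset.sum_comm' fun g p => ?_
      simp only [coloredDartsOutside, Finset.mem_filter, Finset.mem_univ, true_and,
        Finset.forall_mem_insert]
      constructor
      · rintro ⟨hg, ⟨hadj, h₁, h₂⟩, e₁, e₂⟩
        refine ⟨⟨?_, ?_, fun v hv => ?_⟩, hadj, h₁, h₂⟩
        · simp [Function.update_of_ne hadj.ne, e₁]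
        · simp [e₂]
        · rw [Function.update_of_ne (ne_of_mem_of_not_mem hv h₂),
            Function.update_of_ne (ne_of_mem_of_not_mem hv h₁), hg v hv]
      · rintro ⟨⟨e₁, e₂, hg⟩, hadj, h₁, h₂⟩
        refine ⟨fun v hv => ?_, ⟨hadj, h₁, h₂⟩, ?_, ?_⟩
        · rw [hg v hv, Function.update_of_ne (ne_of_mem_of_not_mem hv h₂),
            Function.update_of_ne (ne_of_mem_of_not_mem hv h₁)]
        · simpa [Function.update_of_ne hadj.ne] using e₁
        · simpa using e₂
    rw [hswap, Finset.sum_mul]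
    calc _ ≤ ∑ p ∈ Finset.univ.filter (fun p : V × V => G.Adj p.1 p.2 ∧ p.1 ∉ W ∧ p.2 ∉ W),
          (2 * G.edgeFinset.card) ^ r * c ^ Fintype.card V := by
          refine Finset.sum_le_sum fun p hp => ?_
          obtain ⟨hadj, h₁, h₂⟩ := (Finset.mem_filter.mp hp).2
          have hcard : (insert p.1 (insert p.2 W)).card = W.card + 2 := by
            rw [Finset.card_insert_of_notMem (by simp [hadj.ne, h₁]),
              Finset.card_insert_of_notMem h₂]
          have := ih (insert p.1 (insert p.2 W))
            (Function.update (Function.update h p.1 τ1) p.2 τ2)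
          rwa [hcard, show W.card + 2 + 2 * r = W.card + 2 * (r + 1) by ring] at this
      _ ≤ (2 * G.edgeFinset.card) * ((2 * G.edgeFinset.card) ^ r * c ^ Fintype.card V) := by
          rw [Finset.sum_const, smul_eq_mul, ← card_adj_pairs]
          refine Nat.mul_le_mul_right _ (Finset.card_le_card fun p => ?_)
          simp only [Finset.mem_filter, Finset.mem_univ, true_and]
          exact fun hp => hp.1
      _ = _ := by ring

/-- At most a `(2/3) ^ r` fraction of all colorings has at least `4 * M` edges colored
`{τ1, τ2}`. -/
theorem card_colorings_mul_three_pow_le {M : ℕ} (hM : 0 < M)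
    (hm : G.edgeFinset.card = c ^ 2 * M) {D : ℝ} (hdeg : ∀ v, (G.degree v : ℝ) ≤ D)
    (hD : 0 ≤ D) {r : ℕ} (hr : 4 * r * D ≤ M + 4 * D) :
    (Finset.univ.filter fun g : V → Fin c => 4 * M ≤ colorPairEdgeCount G g τ1 τ2).card * 3 ^ r ≤
      2 ^ r * c ^ Fintype.card V := by
  have hc : 0 < c := τ1.pos
  have hlow : (Finset.univ.filter fun g : V → Fin c =>
      4 * M ≤ colorPairEdgeCount G g τ1 τ2).card * (3 * M) ^ r ≤
      ∑ g : V → Fin c, coloredMatchingCount G τ1 τ2 r ∅ g := by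
    rw [← smul_eq_mul]
    refine (Finset.card_nsmul_le_sum _ (coloredMatchingCount G τ1 τ2 r ∅) _ fun g hg => ?_).trans
      (Finset.sum_le_sum_of_subset (Finset.subset_univ _))
    refine pow_le_coloredMatchingCount G τ1 τ2 hdeg hD ((Finset.mem_filter.mp hg).2.trans
      (colorPairEdgeCount_le_card G τ1 τ2 g)) r ∅ ?_
    simp only [Finset.card_empty, Nat.cast_zero]
    linarith
  have hup := sum_coloredMatchingCount_le G τ1 τ2 r ∅ fun _ => τ1
  simp only [Finset.notMem_empty, false_implies, implies_true, Finset.filter_true,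
    Finset.card_empty, zero_add, hm] at hup
  have hpos : 0 < M ^ r * c ^ (2 * r) := by positivity
  refine Nat.le_of_mul_le_mul_right ?_ hpos
  calc _ = (Finset.univ.filter fun g : V → Fin c =>
        4 * M ≤ colorPairEdgeCount G g τ1 τ2).card * (3 * M) ^ r * c ^ (2 * r) := by
        rw [mul_pow]; ring
    _ ≤ _ := Nat.mul_le_mul_right _ hlow
    _ ≤ _ := hup
    _ = _ := by rw [mul_pow, mul_pow, ← pow_mul]; ring

end

/-- If each value of `X` is taken with outer probability `q`, no measurability of `X` is needed to
bound the probability of an event by counting. -/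
theorem measure_preimage_le_card_mul {Ω : Type v} [MeasurableSpace Ω] (μ : Measure Ω)
    {α : Type u} [Fintype α] (X : Ω → α) (q : ENNReal) (hX : ∀ a, μ {ω | X ω = a} ≤ q)
    (P : α → Prop) [DecidablePred P] :
    μ {ω | P (X ω)} ≤ (Finset.univ.filter P).card * q := by
  have hsub : {ω | P (X ω)} ⊆ ⋃ a ∈ Finset.univ.filter P, {ω | X ω = a} := by
    intro ω hω
    simpa using hω
  refine (measure_mono hsub).trans ((measure_biUnion_finset_le _ _).trans ?_)
  refine (Finset.sum_le_sum fun a _ => hX a).trans ?_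
  simp

/-- There is a universal constant `a > 0` such that for every finite simple graph
`G` with `m = c²·M` edges and maximum degree at most `√m`, if the vertices are colored
independently and uniformly at random with `c` colors, then for every pair of colors
`τ1 ≤ τ2`, `Pr[|E_{τ1,τ2}| ≥ 4M] ≤ exp(−a·M/√m)`. -/
theorem prob_colorClass_ge_fourM_le : ∃ a : ℝ, 0 < a ∧
    ∀ (V : Type u) [Fintype V] [DecidableEq V] (G : SimpleGraph V) [DecidableRel G.Adj]
      (Ω : Type v) [MeasurableSpace Ω] (μ : Measure Ω) [IsProbabilityMeasure μ]
      (c M : ℕ), 0 < c → 0 < M → G.edgeFinset.card = c ^ 2 * M →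
      (∀ v : V, G.degree v ^ 2 ≤ G.edgeFinset.card) →
      ∀ ξ : Ω → V → Fin c,
      (∀ (W : Finset V) (g : V → Fin c),
          μ {ω | ∀ v ∈ W, ξ ω v = g v} = (1 / (c : ENNReal)) ^ W.card) →
      ∀ τ1 τ2 : Fin c, τ1 ≤ τ2 →
      μ {ω | 4 * M ≤ colorPairEdgeCount G (ξ ω) τ1 τ2} ≤
        ENNReal.ofReal (Real.exp (-(a * M) / Real.sqrt G.edgeFinset.card)) := by
  refine ⟨Real.log (3 / 2) / 4, by have := Real.log_pos (x := 3 / 2) (by norm_num); positivity, ?_⟩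
  intro V _ _ G _ Ω _ μ _ c M hc hM hm hdeg ξ hξ τ1 τ2 _
  set D : ℝ := Real.sqrt G.edgeFinset.card with hDdef
  have hmpos : 0 < G.edgeFinset.card := by rw [hm]; positivity
  have hD : 0 < D := Real.sqrt_pos.mpr (by exact_mod_cast hmpos)
  have hdegD : ∀ v, (G.degree v : ℝ) ≤ D := fun v =>
    Real.le_sqrt_of_sq_le (by exact_mod_cast hdeg v)
  set r : ℕ := ⌊(M : ℝ) / (4 * D)⌋₊ + 1 with hrdef
  have hr : 4 * (r : ℝ) * D ≤ M + 4 * D := by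
    have h := Nat.floor_le (show 0 ≤ (M : ℝ) / (4 * D) by positivity)
    rw [le_div_iff₀ (by positivity)] at h
    rw [hrdef]
    push_cast
    linarith
  have hr' : (M : ℝ) / (4 * D) ≤ r := by
    rw [hrdef]
    push_cast
    exact (Nat.lt_floor_add_one _).le
  have hcount := card_colorings_mul_three_pow_le G τ1 τ2 hM hm hdegD hD.le hr
  set N := (Finset.univ.filter fun g : V → Fin c =>
    4 * M ≤ colorPairEdgeCount G g τ1 τ2).card with hN
  have hprob := measure_preimage_le_card_mul μ ξ ((1 / (c : ENNReal)) ^ Fintype.card V)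
    (fun g => by simpa [funext_iff] using (hξ Finset.univ g).le)
    (fun g => 4 * M ≤ colorPairEdgeCount G g τ1 τ2)
  refine hprob.trans ?_
  have hcR : (0 : ℝ) < c := by exact_mod_cast hc
  have hreal : (N : ENNReal) * (1 / (c : ENNReal)) ^ Fintype.card V =
      ENNReal.ofReal (N * (1 / c) ^ Fintype.card V) := by
    rw [ENNReal.ofReal_mul (by positivity), ENNReal.ofReal_pow (by positivity),
      ENNReal.ofReal_div_of_pos hcR]
    simp
  rw [← hN, hreal]
  refine ENNReal.ofReal_le_ofReal ?_
  have hfrac : (N : ℝ) * (1 / c) ^ Fintype.card V ≤ (2 / 3) ^ r := by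
    have h : (N : ℝ) * 3 ^ r ≤ 2 ^ r * c ^ Fintype.card V := by exact_mod_cast hcount
    rw [one_div, inv_pow, ← div_eq_mul_inv, div_pow, div_le_div_iff₀ (by positivity)
      (by positivity)]
    exact h
  refine hfrac.trans ?_
  have hexp : ((2 : ℝ) / 3) ^ r = Real.exp (-(Real.log (3 / 2) * r)) := by
    rw [Real.exp_neg, mul_comm, Real.exp_nat_mul, Real.exp_log (by norm_num), ← inv_pow]
    norm_num
  rw [hexp, Real.exp_le_exp, neg_div, neg_le_neg_iff]
  calc Real.log (3 / 2) / 4 * M / D = Real.log (3 / 2) * (M / (4 * D)) := by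
        field_simp
    _ ≤ _ := mul_le_mul_of_nonneg_left hr' (Real.log_nonneg (by norm_num))
end

section
/- There are universal constants a, C > 0 with the following property. Let G = (V,E) be a finite simple graph with m ≥ 2 edges in which every vertex has degree at most √m, and let c, M be positive integers with m = c²·M and M ≥ C·√m·log m. Color the vertices of G independently and uniformly at random with colors from {1,…,c}. Then with probability at least 1 − 1/m, simultaneously for all pairs of colors τ1 ≤ τ2, |E_{τ1,τ2}| < 4M. -/
open MeasureTheory

universe u v

open Finset in
/-- If the set of colorings satisfying `Q` does not depend on the colors of `u ≠ v`, then at most a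
`2 / c²` fraction of it gives `s(u, v)` a prescribed unordered pair of colors. -/
theorem card_filter_map_eq_and_mul_sq_le {V : Type u} [Fintype V] [DecidableEq V] {c : ℕ}
    {u v : V} (huv : u ≠ v) (τ1 τ2 : Fin c) (Q : (V → Fin c) → Prop) [DecidablePred Q]
    (hQ : ∀ ξ a b, Q ξ → Q (Function.update (Function.update ξ u a) v b)) :
    #{ξ : V → Fin c | Sym2.map ξ s(u, v) = s(τ1, τ2) ∧ Q ξ} * c ^ 2 ≤ 2 * #{ξ | Q ξ} := by
  have key : #(({ξ | Sym2.map ξ s(u, v) = s(τ1, τ2) ∧ Q ξ} : Finset (V → Fin c)) ×ˢ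
      (univ : Finset (Fin c × Fin c))) ≤
      #((univ : Finset Bool) ×ˢ ({ξ | Q ξ} : Finset (V → Fin c))) := by
    refine card_le_card_of_injOn (fun x => (decide (x.1 u = τ1),
      Function.update (Function.update x.1 u x.2.1) v x.2.2)) ?_ ?_
    · rintro ⟨ξ, a, b⟩ h
      simp only [coe_product, Set.mem_prod, mem_coe, mem_filter, mem_univ, true_and,
        and_true] at h ⊢
      exact hQ ξ a b h.2
    · rintro ⟨ξ, a, b⟩ h ⟨ξ', a', b'⟩ h' heq
      simp only [coe_product, Set.mem_prod, mem_coe, mem_filter, mem_univ, true_and,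
        and_true, Sym2.map_mk, Sym2.eq_iff] at h h'
      simp only [Prod.mk.injEq, decide_eq_decide] at heq
      obtain ⟨hor, hup⟩ := heq
      have hb : b = b' := by simpa using congrFun hup v
      have ha : a = a' := by simpa [huv] using congrFun hup u
      have hξ : ξ = ξ' := by
        funext w
        by_cases hwv : w = v
        · grind
        by_cases hwu : w = u
        · grind
        simpa [hwv, hwu] using congrFun hup w
      rw [hξ, ha, hb]
  simpa [card_product, sq] using key

open Finset in
/-- Tail bound, by iterated Markov inequalities, for the number of edges of `F` that receive a
prescribed unordered pair of colors. -/
theorem card_filter_le_card_edges_mul_pow_le {V : Type u} [Fintype V] [DecidableEq V] {c : ℕ}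
    (τ1 τ2 : Fin c) (D K m r : ℕ) (F : Finset (Sym2 V)) (hdiag : ∀ e ∈ F, ¬ e.IsDiag)
    (hdeg : ∀ v, #{e ∈ F | v ∈ e} ≤ D) (hm : #F ≤ m) :
    #{ξ : V → Fin c | K + 2 * D * r ≤ #{e ∈ F | Sym2.map ξ e = s(τ1, τ2)}} * (K * c ^ 2) ^ r ≤
      (2 * m) ^ r * c ^ Fintype.card V := by
  induction r generalizing F with
  | zero =>
    simpa using card_le_univ
      ({ξ : V → Fin c | K ≤ #{e ∈ F | Sym2.map ξ e = s(τ1, τ2)}} : Finset (V → Fin c))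
  | succ r ih =>
    set B : Finset (V → Fin c) :=
      {ξ | K + 2 * D * (r + 1) ≤ #{e ∈ F | Sym2.map ξ e = s(τ1, τ2)}} with hB
    have markov : #B * K ≤ ∑ e ∈ F, #{ξ ∈ B | Sym2.map ξ e = s(τ1, τ2)} := by
      have := sum_card_bipartiteAbove_eq_sum_card_bipartiteBelow (s := B) (t := F)
        (fun ξ e => Sym2.map ξ e = s(τ1, τ2))
      simp only [bipartiteAbove, bipartiteBelow] at this
      rw [← this, ← smul_eq_mul]
      refine card_nsmul_le_sum _ _ _ fun ξ hξ => ?_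
      have := (mem_filter.1 hξ).2
      omega
    have step : ∀ e ∈ F, #{ξ ∈ B | Sym2.map ξ e = s(τ1, τ2)} * c ^ 2 * (K * c ^ 2) ^ r ≤
        2 * ((2 * m) ^ r * c ^ Fintype.card V) := by
      intro e he
      induction e with | _ u v
      have huv : u ≠ v := fun h => hdiag _ he (by simpa using h)
      set F' : Finset (Sym2 V) := {f ∈ F | u ∉ f ∧ v ∉ f} with hF'
      have hsub : F' ⊆ F := filter_subset _ _
      have hind := ih F' (fun f hf => hdiag f (hsub hf))
        (fun w => (card_le_card (filter_subset_filter _ hsub)).trans (hdeg w))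
        ((card_le_card hsub).trans hm)
      have hpair := card_filter_map_eq_and_mul_sq_le huv τ1 τ2
        (fun ξ => K + 2 * D * r ≤ #{f ∈ F' | Sym2.map ξ f = s(τ1, τ2)}) (by
          intro ξ a b h
          refine h.trans (card_le_card fun f hf => ?_)
          obtain ⟨hfF, hf⟩ := mem_filter.1 hf
          refine mem_filter.2 ⟨hfF, ?_⟩
          rw [← hf]
          obtain ⟨-, huf, hvf⟩ := mem_filter.1 hfF
          refine Sym2.map_congr fun w hw => ?_
          rw [Function.update_of_ne (by grind), Function.update_of_ne (by grind)])
      have hle : #{ξ ∈ B | Sym2.map ξ s(u, v) = s(τ1, τ2)} ≤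
          #{ξ : V → Fin c | Sym2.map ξ s(u, v) = s(τ1, τ2) ∧
            K + 2 * D * r ≤ #{f ∈ F' | Sym2.map ξ f = s(τ1, τ2)}} := by
        refine card_le_card fun ξ hξ => ?_
        obtain ⟨hξB, hξ⟩ := mem_filter.1 hξ
        refine mem_filter.2 ⟨mem_univ _, hξ, ?_⟩
        have hξB := (mem_filter.1 hξB).2
        have hcover : ({f ∈ F | Sym2.map ξ f = s(τ1, τ2)} : Finset (Sym2 V)) ⊆
            {f ∈ F' | Sym2.map ξ f = s(τ1, τ2)} ∪ ({f ∈ F | u ∈ f} ∪ {f ∈ F | v ∈ f}) := by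
          intro f hf
          simp only [hF', mem_union, mem_filter] at hf ⊢
          tauto
        have h1 := card_le_card hcover
        have h2 := card_union_le ({f ∈ F' | Sym2.map ξ f = s(τ1, τ2)} : Finset (Sym2 V))
          ({f ∈ F | u ∈ f} ∪ {f ∈ F | v ∈ f})
        have h3 := card_union_le ({f ∈ F | u ∈ f} : Finset (Sym2 V)) {f ∈ F | v ∈ f}
        have h4 := hdeg u
        have h5 := hdeg v
        rw [mul_add, mul_one] at hξB
        omega
      calc _ ≤ (2 * #{ξ : V → Fin c |
              K + 2 * D * r ≤ #{f ∈ F' | Sym2.map ξ f = s(τ1, τ2)}}) * (K * c ^ 2) ^ r :=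
            Nat.mul_le_mul_right _ ((Nat.mul_le_mul_right _ hle).trans hpair)
        _ ≤ _ := by rw [mul_assoc]; exact Nat.mul_le_mul_left _ hind
    calc #B * (K * c ^ 2) ^ (r + 1) = #B * K * (c ^ 2 * (K * c ^ 2) ^ r) := by ring
      _ ≤ (∑ e ∈ F, #{ξ ∈ B | Sym2.map ξ e = s(τ1, τ2)}) * (c ^ 2 * (K * c ^ 2) ^ r) :=
        Nat.mul_le_mul_right _ markov
      _ = ∑ e ∈ F, #{ξ ∈ B | Sym2.map ξ e = s(τ1, τ2)} * c ^ 2 * (K * c ^ 2) ^ r := by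
        simp only [sum_mul, mul_assoc]
      _ ≤ #F * (2 * ((2 * m) ^ r * c ^ Fintype.card V)) := sum_le_card_nsmul _ _ _ step
      _ ≤ m * (2 * ((2 * m) ^ r * c ^ Fintype.card V)) := Nat.mul_le_mul_right _ hm
      _ = (2 * m) ^ (r + 1) * c ^ Fintype.card V := by ring

/-- Number of rounds needed in the iterated Markov bound. -/
theorem exists_rounds {m M : ℕ} (hm : 2 ≤ m)
    (hM : 16 * Real.sqrt m * Real.log m ≤ M) :
    ∃ r : ℕ, 2 * Nat.sqrt m * r ≤ M ∧ 2 ^ r * m ^ 2 ≤ 3 ^ r := by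
  have hm0 : (0 : ℝ) < m := by positivity
  have hlog : 1 / 2 ≤ Real.log m := by
    have h1 : Real.log 2 ≤ Real.log m := Real.log_le_log (by norm_num) (by exact_mod_cast hm)
    have h2 := Real.log_two_gt_d9
    linarith
  refine ⟨⌈6 * Real.log m⌉₊, ?_, ?_⟩
  · have hr := (Nat.ceil_lt_add_one (by linarith : 0 ≤ 6 * Real.log m)).le
    have hs : (Nat.sqrt m : ℝ) ≤ Real.sqrt m := Real.nat_sqrt_le_real_sqrt
    have : (2 * Nat.sqrt m * ⌈6 * Real.log m⌉₊ : ℝ) ≤ M := by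
      calc (2 * Nat.sqrt m * ⌈6 * Real.log m⌉₊ : ℝ)
          ≤ 2 * Real.sqrt m * (8 * Real.log m) := by
            gcongr
            linarith
        _ ≤ M := by linarith
    exact_mod_cast this
  · have hr := Nat.le_ceil (6 * Real.log m)
    set r := ⌈6 * Real.log m⌉₊
    have h32 : 1 / 3 ≤ Real.log (3 / 2) := by
      have := Real.one_sub_inv_le_log_of_pos (by norm_num : (0 : ℝ) < 3 / 2)
      norm_num at this ⊢
      linarith
    have hpow : (m : ℝ) ^ 2 ≤ (3 / 2) ^ r := by
      rw [← Real.log_le_log_iff (by positivity) (by positivity), Real.log_pow, Real.log_pow]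
      push_cast
      nlinarith
    rw [div_pow, le_div_iff₀ (by positivity)] at hpow
    rw [mul_comm]
    exact_mod_cast hpow

theorem colorPairEdgeCount_eq_card_filter {V : Type u} [Fintype V] [DecidableEq V]
    (G : SimpleGraph V) [DecidableRel G.Adj] {c : ℕ} (ξ : V → Fin c) (τ1 τ2 : Fin c) :
    colorPairEdgeCount G ξ τ1 τ2 =
      (G.edgeFinset.filter fun e => Sym2.map ξ e = s(τ1, τ2)).card := by
  rw [colorPairEdgeCount, Nat.subtype_card]
  simp

open Finset in
/-- At most a `1 / m` fraction of all colorings has an overfull color class. -/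
theorem card_exists_fourM_le_mul_le {V : Type u} [Fintype V] [DecidableEq V]
    (G : SimpleGraph V) [DecidableRel G.Adj] {c M : ℕ} (hM : 0 < M)
    (hm : 2 ≤ #G.edgeFinset) (hcM : #G.edgeFinset = c ^ 2 * M)
    (hdeg : ∀ v : V, G.degree v ^ 2 ≤ #G.edgeFinset)
    (hlog : 16 * Real.sqrt #G.edgeFinset * Real.log #G.edgeFinset ≤ M)
    (bad : Finset (V → Fin c))
    (hbad : ∀ ξ ∈ bad, ∃ τ1 τ2 : Fin c, 4 * M ≤ colorPairEdgeCount G ξ τ1 τ2) :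
    #bad * #G.edgeFinset ≤ c ^ Fintype.card V := by
  obtain ⟨r, hr, hpow⟩ := exists_rounds hm hlog
  set m := #G.edgeFinset with hmdef
  let B : Fin c × Fin c → Finset (V → Fin c) := fun τ =>
    {ξ | 3 * M + 2 * Nat.sqrt m * r ≤ #{e ∈ G.edgeFinset | Sym2.map ξ e = s(τ.1, τ.2)}}
  have hB : ∀ τ, #(B τ) * m ^ 2 ≤ c ^ Fintype.card V := by
    intro τ
    have h := card_filter_le_card_edges_mul_pow_le τ.1 τ.2 (Nat.sqrt m) (3 * M) m r
      G.edgeFinset (fun e he => G.not_isDiag_of_mem_edgeFinset he) (fun v => by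
        rw [← G.incidenceFinset_eq_filter, G.card_incidenceFinset_eq_degree]
        exact Nat.le_sqrt'.2 (hdeg v)) le_rfl
    have hK : 3 * M * c ^ 2 = 3 * m := by rw [hcM]; ring
    rw [hK, mul_pow, mul_pow] at h
    have h' : #(B τ) * 3 ^ r ≤ 2 ^ r * c ^ Fintype.card V :=
      Nat.le_of_mul_le_mul_right (c := m ^ r) 
      (by convert h using 1 <;> ring) (by positivity)
    refine le_of_mul_le_mul_left (a := 2 ^ r) ?_ (by positivity)
    calc 2 ^ r * (#(B τ) * m ^ 2) = #(B τ) * (2 ^ r * m ^ 2) := by ring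
      _ ≤ #(B τ) * 3 ^ r := Nat.mul_le_mul_left _ hpow
      _ ≤ _ := h'
  have hcover : bad ⊆ univ.biUnion B := by
    intro ξ hξ
    obtain ⟨τ1, τ2, h⟩ := hbad ξ hξ
    rw [colorPairEdgeCount_eq_card_filter] at h
    refine mem_biUnion.2 ⟨(τ1, τ2), mem_univ _, mem_filter.2 ⟨mem_univ _, ?_⟩⟩
    dsimp only
    omega
  have hcm : c ^ 2 ≤ m := hcM ▸ Nat.le_mul_of_pos_right _ hM
  refine le_of_mul_le_mul_left (a := m) ?_ (by omega)
  calc m * (#bad * m) = #bad * m ^ 2 := by ring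
    _ ≤ (∑ τ, #(B τ)) * m ^ 2 :=
      Nat.mul_le_mul_right _ ((card_le_card hcover).trans card_biUnion_le)
    _ = ∑ τ, #(B τ) * m ^ 2 := sum_mul _ _ _
    _ ≤ #(univ : Finset (Fin c × Fin c)) * c ^ Fintype.card V :=
      sum_le_card_nsmul _ _ _ fun τ _ => hB τ
    _ = c ^ 2 * c ^ Fintype.card V := by simp [sq]
    _ ≤ m * c ^ Fintype.card V := Nat.mul_le_mul_right _ hcm

/-- There are universal constants `a, C > 0` such that for every finite simple
graph `G` with `m = c²·M ≥ 2` edges, maximum degree at most `√m`, and `M ≥ C·√m·log m`, if the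
vertices are colored independently and uniformly at random with `c` colors, then with
probability at least `1 − 1/m` all color classes satisfy `|E_{τ1,τ2}| < 4M` simultaneously. -/
theorem prob_all_colorClasses_lt_fourM : ∃ a C : ℝ, 0 < a ∧ 0 < C ∧
    ∀ (V : Type u) [Fintype V] [DecidableEq V] (G : SimpleGraph V) [DecidableRel G.Adj]
      (Ω : Type v) [MeasurableSpace Ω] (μ : Measure Ω) [IsProbabilityMeasure μ]
      (c M : ℕ), 0 < c → 0 < M → 2 ≤ G.edgeFinset.card →
      G.edgeFinset.card = c ^ 2 * M →
      (∀ v : V, G.degree v ^ 2 ≤ G.edgeFinset.card) →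
      C * Real.sqrt G.edgeFinset.card * Real.log G.edgeFinset.card ≤ M →
      ∀ ξ : Ω → V → Fin c,
      (∀ (W : Finset V) (g : V → Fin c),
          μ {ω | ∀ v ∈ W, ξ ω v = g v} = (1 / (c : ENNReal)) ^ W.card) →
      1 - 1 / (G.edgeFinset.card : ENNReal) ≤
        μ {ω | ∀ τ1 τ2 : Fin c, τ1 ≤ τ2 → colorPairEdgeCount G (ξ ω) τ1 τ2 < 4 * M} := by
  refine ⟨1, 16, one_pos, by norm_num, ?_⟩
  intro V _ _ G _ Ω _ μ _ c M hc hM hm hcM hdeg hlog ξ hξ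
  classical
  set good : Set Ω :=
    {ω | ∀ τ1 τ2 : Fin c, τ1 ≤ τ2 → colorPairEdgeCount G (ξ ω) τ1 τ2 < 4 * M} with hgood
  let bad : Finset (V → Fin c) :=
    {g | ∃ τ1 τ2 : Fin c, 4 * M ≤ colorPairEdgeCount G g τ1 τ2}
  have hcard : bad.card * G.edgeFinset.card ≤ c ^ Fintype.card V :=
    card_exists_fourM_le_mul_le G hM hm hcM hdeg hlog bad fun g hg => (Finset.mem_filter.1 hg).2
  have hcompl : goodᶜ ⊆ ⋃ g ∈ bad, {ω | ∀ v ∈ (Finset.univ : Finset V), ξ ω v = g v} := by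
    intro ω hω
    simp only [hgood, Set.mem_compl_iff, Set.mem_ofPred_eq, not_forall, not_lt] at hω
    obtain ⟨τ1, τ2, -, h⟩ := hω
    exact Set.mem_biUnion (x := ξ ω) (Finset.mem_filter.2 ⟨Finset.mem_univ _, τ1, τ2, h⟩)
      fun v _ => rfl
  have hμ : μ goodᶜ ≤ 1 / (G.edgeFinset.card : ENNReal) := by
    calc μ goodᶜ ≤ ∑ g ∈ bad, μ {ω | ∀ v ∈ (Finset.univ : Finset V), ξ ω v = g v} :=
          (measure_mono hcompl).trans (measure_biUnion_finset_le _ _)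
      _ = bad.card / (c : ENNReal) ^ Fintype.card V := by
          simp only [hξ, Finset.sum_const, nsmul_eq_mul, Finset.card_univ,
            ENNReal.inv_pow, div_eq_mul_inv, one_mul]
      _ ≤ 1 / (G.edgeFinset.card : ENNReal) := by
          have hc0 : (c : ENNReal) ≠ 0 := by exact_mod_cast hc.ne'
          have hm0 : (G.edgeFinset.card : ENNReal) ≠ 0 := by
            exact_mod_cast (show G.edgeFinset.card ≠ 0 by omega)
          rw [ENNReal.div_le_iff (pow_ne_zero _ hc0)
            (ENNReal.pow_ne_top (ENNReal.natCast_ne_top c)), mul_comm, mul_one_div,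
            ENNReal.le_div_iff_mul_le (Or.inl hm0) (Or.inl (ENNReal.natCast_ne_top _))]
          exact_mod_cast hcard
  rw [tsub_le_iff_right]
  calc (1 : ENNReal) = μ (good ∪ goodᶜ) := by rw [Set.union_compl_self, measure_univ]
    _ ≤ μ good + μ goodᶜ := measure_union_le _ _
    _ ≤ _ := by gcongr
end

section
/- There is a universal constant a > 0 with the following property. Let G = (V,E) be a finite simple graph with m edges and maximum vertex degree at most √(m·M), and let c, M be positive integers with m = c²·M. Call a vertex high if its degree is at least √m and low otherwise. Suppose the high vertices are assigned fixed colors from {1,…,c} in such a way that for every color the total degree of the high vertices of that color is at most 2√(m·M), and the low vertices are colored independently and uniformly at random from {1,…,c}. Then for every pair of colors τ1 ≤ τ2, the set of edges of G that have at least one high endpoint and whose endpoints receive the unordered color pair {τ1,τ2} has size at least 16M with probability at most exp(−a·M/√m). -/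
open MeasureTheory

universe u v

open Finset in
/-- Exponential Markov inequality for a sum over uniformly coloured vertices. The colouring `ξ` need
not be measurable: only subadditivity of `μ` is used. -/
lemma measure_le_sum_le_exp_mul_prod {Ω : Type*} [MeasurableSpace Ω] (μ : Measure Ω)
    {V : Type*} [DecidableEq V] {c : ℕ} (hc : 0 < c) (ξ : Ω → V → Fin c) (L : Finset V)
    (hξ : ∀ g : V → Fin c, μ {ω | ∀ v ∈ L, ξ ω v = g v} = (1 / (c : ENNReal)) ^ #L)
    (w : V → Fin c → ℝ) (t : ℝ) :
    μ {ω | t ≤ ∑ v ∈ L, w v (ξ ω v)} ≤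
      ENNReal.ofReal (Real.exp (-t) * ∏ v ∈ L, ∑ k, Real.exp (w v k) / c) := by
  classical
  let A : Finset (L → Fin c) := univ.filter fun g => t ≤ ∑ v : L, w v (g v)
  have hcover : {ω | t ≤ ∑ v ∈ L, w v (ξ ω v)} ⊆ ⋃ g ∈ A, {ω | ∀ v : L, ξ ω v = g v} := by
    intro ω hω
    simp only [Set.mem_iUnion]
    refine ⟨fun v => ξ ω v, ?_, fun v => rfl⟩
    simp only [A, mem_filter, mem_univ, true_and]
    rw [Set.mem_ofPred_eq, ← Finset.sum_coe_sort] at hω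
    exact hω
  have hμ (g : L → Fin c) :
      μ {ω | ∀ v : L, ξ ω v = g v} = ENNReal.ofReal ((1 / (c : ℝ)) ^ #L) := by
    have h := hξ fun v => if hv : v ∈ L then g ⟨v, hv⟩ else ⟨0, hc⟩
    have hset : {ω | ∀ v : L, ξ ω v = g v} =
        {ω | ∀ v ∈ L, ξ ω v = if hv : v ∈ L then g ⟨v, hv⟩ else ⟨0, hc⟩} := by
      ext ω
      simp only [Set.mem_ofPred_eq, Subtype.forall]
      refine forall₂_congr fun v hv => ?_
      rw [dif_pos hv]
    rw [hset, h, ENNReal.ofReal_pow (by positivity), ENNReal.ofReal_div_of_pos (by positivity)]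
    simp
  calc μ {ω | t ≤ ∑ v ∈ L, w v (ξ ω v)}
      ≤ ∑ g ∈ A, μ {ω | ∀ v : L, ξ ω v = g v} :=
        (measure_mono hcover).trans (measure_biUnion_finset_le _ _)
    _ = ENNReal.ofReal (∑ g ∈ A, (1 / (c : ℝ)) ^ #L) := by
        rw [ENNReal.ofReal_sum_of_nonneg fun _ _ => by positivity]
        exact sum_congr rfl fun g _ => hμ g
    _ ≤ _ := ENNReal.ofReal_le_ofReal ?_
  calc ∑ g ∈ A, (1 / (c : ℝ)) ^ #L
      ≤ ∑ g ∈ A, Real.exp (-t) * ∏ v : L, Real.exp (w v (g v)) / c := by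
        refine sum_le_sum fun g hg => ?_
        have hg' : t ≤ ∑ v : L, w v (g v) := (mem_filter.1 hg).2
        rw [prod_div_distrib, ← Real.exp_sum, mul_div_assoc', ← Real.exp_add]
        simp only [prod_const, card_univ, Fintype.card_coe, one_div, inv_pow]
        rw [inv_eq_one_div]
        gcongr
        rw [Real.one_le_exp_iff]
        linarith
    _ ≤ ∑ g : L → Fin c, Real.exp (-t) * ∏ v : L, Real.exp (w v (g v)) / c :=
        sum_le_sum_of_subset_of_nonneg (subset_univ _) fun _ _ _ => by positivity
    _ = Real.exp (-t) * ∏ v ∈ L, ∑ k, Real.exp (w v k) / c := by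
        rw [← mul_sum, ← prod_coe_sort L, Finset.prod_univ_sum]
        simp [Fintype.piFinset_univ]

open Finset in
/-- If weights in `[0, 1]` have total at most `c * s`, then the uniform exponential moments multiply
to at most `exp (2 * s)`. -/
lemma prod_sum_exp_div_le {V : Type*} {c : ℕ} (hc : 0 < c) (L : Finset V) (w : V → Fin c → ℝ)
    (h0 : ∀ v k, 0 ≤ w v k) (h1 : ∀ v k, w v k ≤ 1) {s : ℝ}
    (hs : ∑ v ∈ L, ∑ k, w v k ≤ c * s) :
    ∏ v ∈ L, ∑ k, Real.exp (w v k) / c ≤ Real.exp (2 * s) := by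
  have hc' : (0 : ℝ) < c := by exact_mod_cast hc
  calc ∏ v ∈ L, ∑ k, Real.exp (w v k) / c
      ≤ ∏ v ∈ L, Real.exp (2 / c * ∑ k, w v k) := by
        refine prod_le_prod (fun v _ => by positivity) fun v _ => ?_
        calc ∑ k, Real.exp (w v k) / c ≤ ∑ k, (1 + 2 * w v k) / c := by
              gcongr with k
              have h := Real.abs_exp_sub_one_le (x := w v k) (by
                rw [abs_of_nonneg (h0 v k)]; exact h1 v k)
              rw [abs_of_nonneg (h0 v k)] at h
              linarith [le_abs_self (Real.exp (w v k) - 1)]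
          _ = 2 / c * ∑ k, w v k + 1 := by
              rw [← sum_div, sum_add_distrib, ← mul_sum]
              simp
              field_simp
              ring
          _ ≤ _ := Real.add_one_le_exp _
    _ = Real.exp (2 / c * ∑ v ∈ L, ∑ k, w v k) := by rw [← Real.exp_sum, mul_sum]
    _ ≤ _ := by
        rw [Real.exp_le_exp]
        calc 2 / c * ∑ v ∈ L, ∑ k, w v k ≤ 2 / c * (c * s) := by gcongr
          _ = 2 * s := by field_simp

open Finset in
/-- Edges meeting `H` with colour pair `p` either lie inside `H` or join a vertex of `H` to a vertex
outside `H`. -/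
lemma card_edges_meeting_le {V α : Type*} [Fintype V] [DecidableEq V] [DecidableEq α]
    (G : SimpleGraph V) [DecidableRel G.Adj] (H : V → Prop) [DecidablePred H] (f χ : V → α)
    (hf : ∀ v, H v → f v = χ v) (a b : α) :
    Nat.card {e : Sym2 V // e ∈ G.edgeSet ∧ (∃ v ∈ e, H v) ∧ Sym2.map f e = s(a, b)} ≤
      #{v | H v ∧ χ v = a} * #{v | H v ∧ χ v = b} +
        ∑ v with ¬ H v, #{u | G.Adj v u ∧ H u ∧ s(χ u, f v) = s(a, b)} := by
  classical
  rw [Nat.card_eq_fintype_card, Fintype.card_subtype]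
  have hsub : (univ.filter fun e : Sym2 V =>
      e ∈ G.edgeSet ∧ (∃ v ∈ e, H v) ∧ Sym2.map f e = s(a, b)) ⊆
      (({v | H v ∧ χ v = a} : Finset V) ×ˢ ({v | H v ∧ χ v = b} : Finset V)).image
          (fun p => s(p.1, p.2)) ∪
        ({v | ¬ H v} : Finset V).biUnion fun v =>
          ({u | G.Adj v u ∧ H u ∧ s(χ u, f v) = s(a, b)} : Finset V).image fun u => s(u, v) := by
    intro e he
    obtain ⟨hadj, ⟨u, hu, hHu⟩, hmap⟩ := (mem_filter.1 he).2
    obtain ⟨v, rfl⟩ := Sym2.mem_iff_exists.1 hu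
    rw [Sym2.map_mk, hf u hHu] at hmap
    rw [SimpleGraph.mem_edgeSet] at hadj
    rw [mem_union]
    by_cases hHv : H v
    · left
      rw [hf v hHv] at hmap
      rw [mem_image]
      rcases Sym2.eq_iff.1 hmap with ⟨h1, h2⟩ | ⟨h1, h2⟩
      · exact ⟨(u, v), by simp [hHu, hHv, h1, h2], rfl⟩
      · exact ⟨(v, u), by simp [hHu, hHv, h1, h2], Sym2.eq_swap⟩
    · right
      rw [mem_biUnion]
      refine ⟨v, by simp [hHv], mem_image.2 ⟨u, ?_, rfl⟩⟩
      simp only [mem_filter, mem_univ, true_and]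
      exact ⟨hadj.symm, hHu, hmap⟩
  refine (card_le_card hsub).trans ((card_union_le _ _).trans (add_le_add ?_ ?_))
  · exact card_image_le.trans (card_product _ _).le
  · exact card_biUnion_le.trans (sum_le_sum fun v _ => card_image_le)

open Finset in
/-- Vertices of colour `k` outside `H` only meet the two classes `a` and `b` inside `H`. -/
lemma card_filter_color_pair_le {V α : Type*} [Fintype V] [DecidableEq α]
    (G : SimpleGraph V) [DecidableRel G.Adj] (H : V → Prop) [DecidablePred H] (χ : V → α)
    (a b k : α) {B : ℝ} (hB : ∀ j, (#{v | H v ∧ χ v = j} : ℝ) ≤ B) (v : V) :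
    (#{u | G.Adj v u ∧ H u ∧ s(χ u, k) = s(a, b)} : ℝ) ≤ B := by
  by_cases hk : k = a
  · refine le_trans ?_ (hB b)
    refine Nat.cast_le.2 (card_le_card (monotone_filter_right _ ?_))
    rintro u - ⟨-, hu, h⟩
    exact ⟨hu, by grind [Sym2.eq_iff]⟩
  · refine le_trans ?_ (hB a)
    refine Nat.cast_le.2 (card_le_card (monotone_filter_right _ ?_))
    rintro u - ⟨-, hu, h⟩
    exact ⟨hu, by grind [Sym2.eq_iff]⟩

open Finset in
lemma sum_card_adj_le_sum_degree {V : Type*} [Fintype V] (G : SimpleGraph V)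
    [DecidableRel G.Adj] (L : Finset V) (P : V → Prop) [DecidablePred P] :
    ∑ v ∈ L, #{u | G.Adj v u ∧ P u} ≤ ∑ u with P u, G.degree u := by
  classical
  calc ∑ v ∈ L, #{u | G.Adj v u ∧ P u} ≤ ∑ v, #{u | G.Adj v u ∧ P u} :=
        sum_le_sum_of_subset (subset_univ _)
    _ = ∑ v, ∑ u with P u, if G.Adj v u then 1 else 0 := by
        refine sum_congr rfl fun v _ => ?_
        rw [← card_filter, filter_filter]
        simp only [and_comm]
    _ = ∑ u with P u, G.degree u := by
        rw [sum_comm]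
        refine sum_congr rfl fun u _ => ?_
        rw [← card_filter, ← G.card_neighborFinset_eq_degree, G.neighborFinset_eq_filter]
        simp only [G.adj_comm]

open Finset in
lemma sum_sum_card_color_pair_le {V α : Type*} [Fintype V] [Fintype α] [DecidableEq α]
    (G : SimpleGraph V) [DecidableRel G.Adj] (H : V → Prop) [DecidablePred H] (χ : V → α)
    (L : Finset V) (a b : α) :
    ∑ v ∈ L, ∑ k, #{u | G.Adj v u ∧ H u ∧ s(χ u, k) = s(a, b)} ≤
      ∑ u with H u ∧ χ u = a, G.degree u + ∑ u with H u ∧ χ u = b, G.degree u := by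
  classical
  refine le_trans ?_ (add_le_add (sum_card_adj_le_sum_degree G L _)
    (sum_card_adj_le_sum_degree G L _))
  rw [← sum_add_distrib]
  refine sum_le_sum fun v _ => ?_
  calc ∑ k, #{u | G.Adj v u ∧ H u ∧ s(χ u, k) = s(a, b)}
      ≤ ∑ k, ((if k = b then #{u | G.Adj v u ∧ H u ∧ χ u = a} else 0) +
          (if k = a then #{u | G.Adj v u ∧ H u ∧ χ u = b} else 0)) := by
        refine sum_le_sum fun k _ => ?_
        have hsub : ({u | G.Adj v u ∧ H u ∧ s(χ u, k) = s(a, b)} : Finset V) ⊆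
            (if k = b then ({u | G.Adj v u ∧ H u ∧ χ u = a} : Finset V) else ∅) ∪
            (if k = a then ({u | G.Adj v u ∧ H u ∧ χ u = b} : Finset V) else ∅) := by
          intro u hu
          obtain ⟨h1, h2, h3⟩ := (mem_filter.1 hu).2
          rcases Sym2.eq_iff.1 h3 with ⟨h4, h5⟩ | ⟨h4, h5⟩ <;> simp [h1, h2, h4, h5]
        refine (card_le_card hsub).trans ((card_union_le _ _).trans (le_of_eq ?_))
        split_ifs <;> simp
    _ = _ := by rw [sum_add_distrib]; simp

open Finset in
/-- If every vertex of a class has degree at least `√m`, a bound `2√(mM)` on the total degree bounds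
the size of the class by `2√M`. -/
lemma card_le_two_mul_sqrt {V : Type*} [Fintype V] (G : SimpleGraph V) [DecidableRel G.Adj]
    (S : Finset V) {m M : ℕ} (hm : 0 < m) (hS : ∀ v ∈ S, m ≤ G.degree v ^ 2)
    (h : ∑ v ∈ S, (G.degree v : ℝ) ≤ 2 * Real.sqrt (m * M)) :
    (#S : ℝ) ≤ 2 * Real.sqrt M := by
  have hpos : 0 < Real.sqrt m := Real.sqrt_pos.2 (by exact_mod_cast hm)
  have h1 : #S * Real.sqrt m ≤ ∑ v ∈ S, (G.degree v : ℝ) := by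
    rw [← nsmul_eq_mul]
    refine card_nsmul_le_sum _ _ _ fun v hv => ?_
    refine Real.sqrt_le_iff.2 ⟨by positivity, by exact_mod_cast hS v hv⟩
  rw [Real.sqrt_mul (by positivity)] at h
  refine le_of_mul_le_mul_right ?_ hpos
  linarith

/-- There is a universal constant `a > 0` with the following property. Let `G` be
a finite simple graph with `m = c²·M` edges and maximum degree at most `√(m·M)`. Call a vertex
*high* if its degree is at least `√m` (expressed as `m ≤ deg(v)²`) and *low* otherwise. Suppose
the high vertices get fixed colors `χ` such that for every color the total degree of the high
vertices of that color is at most `2√(m·M)`, and the low vertices are colored independently and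
uniformly at random. Then for every pair of colors `τ1 ≤ τ2`, the number of edges with at least
one high endpoint whose endpoints receive the unordered color pair `{τ1,τ2}` is at least `16M`
with probability at most `exp(−a·M/√m)`. -/
theorem prob_highDegree_colorClass_ge_sixteenM : ∃ a : ℝ, 0 < a ∧
    ∀ (V : Type u) [Fintype V] [DecidableEq V] (G : SimpleGraph V) [DecidableRel G.Adj]
      (Ω : Type v) [MeasurableSpace Ω] (μ : Measure Ω) [IsProbabilityMeasure μ]
      (c M : ℕ), 0 < c → 0 < M → G.edgeFinset.card = c ^ 2 * M →
      (∀ v : V, G.degree v ^ 2 ≤ G.edgeFinset.card * M) →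
      ∀ (χ : V → Fin c) (ξ : Ω → V → Fin c),
      (∀ (ω : Ω) (v : V), G.edgeFinset.card ≤ G.degree v ^ 2 → ξ ω v = χ v) →
      (∀ τ : Fin c,
          (∑ v ∈ Finset.univ.filter
              (fun v => G.edgeFinset.card ≤ G.degree v ^ 2 ∧ χ v = τ), (G.degree v : ℝ)) ≤
            2 * Real.sqrt (G.edgeFinset.card * M)) →
      (∀ (W : Finset V) (g : V → Fin c),
          (∀ v ∈ W, G.degree v ^ 2 < G.edgeFinset.card) →
          μ {ω | ∀ v ∈ W, ξ ω v = g v} = (1 / (c : ENNReal)) ^ W.card) →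
      ∀ τ1 τ2 : Fin c, τ1 ≤ τ2 →
      μ {ω | 16 * M ≤ Nat.card {e : Sym2 V // e ∈ G.edgeSet ∧
              (∃ v ∈ e, G.edgeFinset.card ≤ G.degree v ^ 2) ∧
              Sym2.map (ξ ω) e = s(τ1, τ2)}} ≤
        ENNReal.ofReal (Real.exp (-(a * M) / Real.sqrt G.edgeFinset.card)) := by
  classical
  refine ⟨1, one_pos, ?_⟩
  intro V _ _ G _ Ω _ μ _ c M hc hM hm _ χ ξ hχ hdeg hunif τ1 τ2 _
  have hMpos : (0 : ℝ) < M := by exact_mod_cast hM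
  have hcone : (1 : ℝ) ≤ c := by exact_mod_cast hc
  have hcpos : (0 : ℝ) < c := by linarith
  have hmpos : 0 < G.edgeFinset.card := by rw [hm]; positivity
  have hmreal : (G.edgeFinset.card : ℝ) = c ^ 2 * M := by rw [hm]; push_cast; ring
  generalize G.edgeFinset.card = m at *
  set r : ℝ := Real.sqrt M with hr
  have hrpos : 0 < r := Real.sqrt_pos.2 hMpos
  have hrr : r * r = M := Real.mul_self_sqrt hMpos.le
  have hsqrt_m : Real.sqrt m = c * r := by
    rw [hmreal, Real.sqrt_mul (by positivity), Real.sqrt_sq hcpos.le]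
  have hsqrt_mM : Real.sqrt (m * M) = c * M := by
    rw [Real.sqrt_mul (by positivity), hsqrt_m, ← hr, mul_assoc, hrr]
  let H : V → Prop := fun v => m ≤ G.degree v ^ 2
  let L : Finset V := {v | ¬ H v}
  have hB (j : Fin c) : ((Finset.univ.filter fun v => H v ∧ χ v = j).card : ℝ) ≤ 2 * r :=
    card_le_two_mul_sqrt G _ hmpos (fun v hv => (Finset.mem_filter.1 hv).2.1) (hdeg j)
  let d : V → Fin c → ℕ := fun v k =>
    (Finset.univ.filter fun u => G.Adj v u ∧ H u ∧ s(χ u, k) = s(τ1, τ2)).card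
  let w : V → Fin c → ℝ := fun v k => d v k / (2 * r)
  have hw0 (v k) : 0 ≤ w v k := by positivity
  have hw1 (v k) : w v k ≤ 1 := by
    rw [div_le_one (by positivity)]
    exact card_filter_color_pair_le G H χ τ1 τ2 k hB v
  have hws : ∑ v ∈ L, ∑ k, w v k ≤ c * (2 * r) := by
    have h : ((∑ v ∈ L, ∑ k, d v k : ℕ) : ℝ) ≤ 4 * (c * M) := by
      refine (Nat.cast_le.2 (sum_sum_card_color_pair_le G H χ L τ1 τ2)).trans ?_
      push_cast
      have h1 := hdeg τ1
      have h2 := hdeg τ2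
      rw [hsqrt_mM] at h1 h2
      linarith
    simp only [w, ← Finset.sum_div]
    rw [div_le_iff₀ (by positivity)]
    push_cast at h
    linear_combination h - 4 * c * hrr
  have hsub : {ω | 16 * M ≤ Nat.card {e : Sym2 V // e ∈ G.edgeSet ∧
      (∃ v ∈ e, m ≤ G.degree v ^ 2) ∧ Sym2.map (ξ ω) e = s(τ1, τ2)}} ⊆
      {ω | 6 * r ≤ ∑ v ∈ L, w v (ξ ω v)} := by
    intro ω hω
    rw [Set.mem_ofPred_eq] at hω ⊢
    have h1 := hω.trans (card_edges_meeting_le G H (ξ ω) χ (hχ ω) τ1 τ2)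
    have h2 := Nat.cast_le (α := ℝ).2 h1
    have h3 := mul_le_mul (hB τ1) (hB τ2) (by positivity) (by positivity)
    simp only [w, ← Finset.sum_div]
    rw [le_div_iff₀ (by positivity)]
    push_cast at h2
    linear_combination h2 + h3 + 16 * hrr
  refine (measure_mono hsub).trans ((measure_le_sum_le_exp_mul_prod μ hc ξ L
    (fun g => hunif L g fun v hv => not_le.1 (Finset.mem_filter.1 hv).2) w (6 * r)).trans
    (ENNReal.ofReal_le_ofReal ?_))
  refine (mul_le_mul_of_nonneg_left (prod_sum_exp_div_le hc L w hw0 hw1 hws)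
    (Real.exp_pos _).le).trans ?_
  rw [← Real.exp_add, Real.exp_le_exp, hsqrt_m, one_mul, neg_div, ← hrr,
    mul_div_mul_right _ _ hrpos.ne']
  linarith [div_le_self hrpos.le hcone]
end

section
/- Let k and s be integers with 1 ≤ s and 2s < k, and let P : {1,…,k−s−1} → {k−s+1,…,k} be any function satisfying P(i) = k−s+i for every 1 ≤ i ≤ s. Then for every set V, the map sending a k-tuple (v_1,…,v_k) ∈ V^k to the pair consisting of the tuple of ordered pairs ((v_1, v_{P(1)}), …, (v_{k−s−1}, v_{P(k−s−1)})) together with the vertex v_{k−s} is injective. -/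
/-- For `1 ≤ s` and `2s < k`, and any probe-index function
`P : {1,…,k−s−1} → {k−s+1,…,k}` with `P(i) = k−s+i` for `1 ≤ i ≤ s`, the map sending a
`k`-tuple `(v_1,…,v_k)` to the family of pairs `(v_i, v_{P(i)})`, `1 ≤ i ≤ k−s−1`, together
with the vertex `v_{k−s}`, is injective. -/
theorem instance_determined_by_probe_edges (k s : ℕ) (hs : 1 ≤ s) (hk : 2 * s < k)
    (P : ℕ → ℕ)
    (hP : ∀ i, 1 ≤ i → i ≤ k - s - 1 → k - s + 1 ≤ P i ∧ P i ≤ k)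
    (hPs : ∀ i, 1 ≤ i → i ≤ s → P i = k - s + i)
    (V : Type*) :
    Function.Injective (fun v : Fin k → V =>
      ((fun i : Fin (k - s - 1) =>
          (v ⟨i.1, by have := i.2; omega⟩,
           v ⟨P (i.1 + 1) - 1, by
              have h1 := i.2
              have h2 := hP (i.1 + 1) (by omega) (by omega)
              omega⟩)),
       v ⟨k - s - 1, by omega⟩)) := by
  intro v w h
  obtain ⟨hpairs, hlast⟩ := Prod.mk.inj h
  funext j
  have hj := j.2
  rcases lt_trichotomy j.1 (k - s - 1) with hlt | heq | hgt
  · exact (Prod.mk.inj (congrFun hpairs ⟨j.1, hlt⟩)).1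
  · have hidx : j = ⟨k - s - 1, by omega⟩ := Fin.ext heq
    rw [hidx]
    exact hlast
  · have hprobe := (Prod.mk.inj (congrFun hpairs ⟨j.1 - (k - s), by omega⟩)).2
    have hP_eq := hPs (j.1 - (k - s) + 1) (by omega) (by omega)
    have hidx : j = ⟨P (j.1 - (k - s) + 1) - 1, by omega⟩ := Fin.ext (by dsimp only; omega)
    rw [hidx]
    exact hprobe
end

section
/- Let c ≥ 1, k ≥ 2, and p ≥ 1 be integers, and let a_{σ1,σ2} ≥ 0 be nonnegative real numbers indexed by pairs of colors 1 ≤ σ1 ≤ σ2 ≤ c. Then Σ over all k-tuples (τ_1,…,τ_k) ∈ {1,…,c}^k of ( Σ_{1≤i<j≤k} a_{min(τ_i,τ_j), max(τ_i,τ_j)} )^p is at most k^{2p} · c^{k−2} · Σ_{1≤σ1≤σ2≤c} a_{σ1,σ2}^p. -/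
/-- The number of functions with prescribed values at two distinct points. -/
theorem card_filter_apply_eq_and_apply_eq {ι α : Type*} [Fintype ι] [DecidableEq ι]
    [Fintype α] [DecidableEq α] {i j : ι} (hij : i ≠ j) (x y : α) :
    (Finset.univ.filter (fun τ : ι → α => (τ i, τ j) = (x, y))).card =
      Fintype.card α ^ (Fintype.card ι - 2) := by
  have hset : Finset.univ.filter (fun τ : ι → α => (τ i, τ j) = (x, y)) =
      Fintype.piFinset (fun l => if l = i then {x} else if l = j then {y} else Finset.univ) := by
    ext τ
    simp only [Finset.mem_filter, Finset.mem_univ, true_and, Prod.mk.injEq,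
      Fintype.mem_piFinset]
    constructor
    · rintro ⟨hi, hj⟩ l
      split_ifs with h h' <;> simp_all
    · intro h
      have hi := h i
      have hj := h j
      simp_all [hij.symm]
  have hj : j ∈ Finset.univ.erase i := by simp [hij.symm]
  rw [hset, Fintype.card_piFinset, ← Finset.mul_prod_erase _ _ (Finset.mem_univ i),
    ← Finset.mul_prod_erase _ _ hj]
  have hrest : ∀ l ∈ (Finset.univ.erase i).erase j,
      (if l = i then {x} else if l = j then {y} else (Finset.univ : Finset α)).card =
        Fintype.card α := by
    intro l hl
    simp only [Finset.mem_erase] at hl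
    simp [hl.1, hl.2.1]
  rw [Finset.prod_congr rfl hrest, Finset.prod_const, Finset.card_erase_of_mem hj,
    Finset.card_erase_of_mem (Finset.mem_univ i)]
  simp [hij.symm, Nat.sub_sub]

/-- Summing over all functions a quantity depending only on two coordinates. -/
theorem sum_apply_apply_eq {ι α : Type*} [Fintype ι] [DecidableEq ι]
    [Fintype α] [DecidableEq α] {i j : ι} (hij : i ≠ j) (f : α × α → ℝ) :
    ∑ τ : ι → α, f (τ i, τ j) =
      (Fintype.card α : ℝ) ^ (Fintype.card ι - 2) * ∑ xy : α × α, f xy := by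
  rw [← Finset.sum_fiberwise Finset.univ (fun τ : ι → α => (τ i, τ j)), Finset.mul_sum]
  refine Finset.sum_congr rfl fun xy _ => ?_
  rw [Finset.sum_congr rfl (g := fun _ => f xy)
      (fun τ hτ => by rw [(Finset.mem_filter.mp hτ).2]),
    Finset.sum_const, card_filter_apply_eq_and_apply_eq hij xy.1 xy.2, nsmul_eq_mul]
  push_cast
  rfl

/-- Each unordered pair arises from at most two ordered pairs. -/
theorem sum_min_max_le_two_mul {α : Type*} [Fintype α] [LinearOrder α] (f : α × α → ℝ)
    (hf : ∀ x y : α, x ≤ y → 0 ≤ f (x, y)) :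
    ∑ xy : α × α, f (min xy.1 xy.2, max xy.1 xy.2) ≤
      2 * ∑ xy ∈ Finset.univ.filter (fun xy : α × α => xy.1 ≤ xy.2), f xy := by
  have hswap : ∑ xy : α × α, (if xy.2 ≤ xy.1 then f (xy.2, xy.1) else 0) =
      ∑ xy : α × α, (if xy.1 ≤ xy.2 then f xy else 0) :=
    (Equiv.prodComm α α).sum_comp (fun xy => if xy.1 ≤ xy.2 then f xy else 0)
  rw [Finset.sum_filter, two_mul]
  nth_rewrite 2 [← hswap]
  rw [← Finset.sum_add_distrib]
  refine Finset.sum_le_sum fun xy _ => ?_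
  obtain ⟨x, y⟩ := xy
  rcases le_total x y with h | h
  · have : 0 ≤ if y ≤ x then f (y, x) else 0 := by
      split_ifs with h'
      exacts [hf y x h', le_rfl]
    simpa [h] using this
  · have : 0 ≤ if x ≤ y then f (x, y) else 0 := by
      split_ifs with h'
      exacts [hf x y h', le_rfl]
    simpa [h] using this

/-- There are at most `k ^ 2 / 2` pairs `i < j`. -/
theorem two_mul_card_filter_lt_le (k : ℕ) :
    2 * (Finset.univ.filter (fun ij : Fin k × Fin k => ij.1 < ij.2)).card ≤ k ^ 2 := by
  have hswap : (Finset.univ.filter (fun ij : Fin k × Fin k => ij.1 < ij.2)).card ≤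
      (Finset.univ.filter (fun ij : Fin k × Fin k => ¬ ij.1 < ij.2)).card := by
    refine Finset.card_le_card_of_injOn Prod.swap (fun ij hij => ?_)
      Prod.swap_injective.injOn
    simp only [Finset.coe_filter, Finset.mem_univ, true_and, Set.mem_ofPred_eq] at hij ⊢
    exact not_lt.mpr hij.le
  have htotal := Finset.card_filter_add_card_filter_not (s := Finset.univ)
    (fun ij : Fin k × Fin k => ij.1 < ij.2)
  simp only [Finset.card_univ, Fintype.card_prod, Fintype.card_fin] at htotal
  nlinarith

/-- The summation inequality used in the analysis of the randomized algorithm: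
for nonnegative reals `a σ1 σ2` indexed by color pairs `σ1 ≤ σ2`,
`Σ_{(τ_1,…,τ_k)} (Σ_{i<j} a_{min(τ_i,τ_j),max(τ_i,τ_j)})^p
  ≤ k^{2p} · c^{k−2} · Σ_{σ1≤σ2} a_{σ1,σ2}^p`. -/
theorem sum_pow_color_tuples_le (c k p : ℕ) (hc : 1 ≤ c) (hk : 2 ≤ k) (hp : 1 ≤ p)
    (a : Fin c → Fin c → ℝ) (ha : ∀ σ1 σ2 : Fin c, σ1 ≤ σ2 → 0 ≤ a σ1 σ2) :
    ∑ τ : Fin k → Fin c,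
        (∑ ij ∈ Finset.univ.filter (fun ij : Fin k × Fin k => ij.1 < ij.2),
            a (min (τ ij.1) (τ ij.2)) (max (τ ij.1) (τ ij.2))) ^ p ≤
      (k : ℝ) ^ (2 * p) * (c : ℝ) ^ (k - 2) *
        ∑ στ ∈ Finset.univ.filter (fun στ : Fin c × Fin c => στ.1 ≤ στ.2),
          a στ.1 στ.2 ^ p := by
  set P := Finset.univ.filter (fun ij : Fin k × Fin k => ij.1 < ij.2) with hP
  set S := ∑ στ ∈ Finset.univ.filter (fun στ : Fin c × Fin c => στ.1 ≤ στ.2),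
    a στ.1 στ.2 ^ p with hS
  obtain ⟨q, rfl⟩ : ∃ q, p = q + 1 := ⟨p - 1, by omega⟩
  have ha' : ∀ x y : Fin c, 0 ≤ a (min x y) (max x y) := fun x y => ha _ _ min_le_max
  have hS0 : 0 ≤ S := Finset.sum_nonneg fun στ h =>
    pow_nonneg (ha _ _ (Finset.mem_filter.mp h).2) _
  have hcard : (0 : ℝ) < P.card := by
    have : (⟨0, by omega⟩, ⟨1, by omega⟩) ∈ P := by simp [hP]
    exact_mod_cast Finset.card_pos.mpr ⟨_, this⟩
  have hmean : ∀ τ : Fin k → Fin c,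
      (∑ ij ∈ P, a (min (τ ij.1) (τ ij.2)) (max (τ ij.1) (τ ij.2))) ^ (q + 1) ≤
        (P.card : ℝ) ^ q *
          ∑ ij ∈ P, a (min (τ ij.1) (τ ij.2)) (max (τ ij.1) (τ ij.2)) ^ (q + 1) := by
    intro τ
    exact (div_le_iff₀' (by positivity)).mp
      (pow_sum_div_card_le_sum_pow (fun ij _ => ha' (τ ij.1) (τ ij.2)) q)
  have hpair : ∀ ij ∈ P,
      ∑ τ : Fin k → Fin c, a (min (τ ij.1) (τ ij.2)) (max (τ ij.1) (τ ij.2)) ^ (q + 1) ≤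
        (c : ℝ) ^ (k - 2) * (2 * S) := by
    intro ij hij
    have hne : ij.1 ≠ ij.2 := (Finset.mem_filter.mp hij).2.ne
    have hsum := sum_apply_apply_eq hne
      (fun xy : Fin c × Fin c => a (min xy.1 xy.2) (max xy.1 xy.2) ^ (q + 1))
    simp only [Fintype.card_fin] at hsum
    rw [hsum]
    gcongr
    exact sum_min_max_le_two_mul (fun xy => a xy.1 xy.2 ^ (q + 1))
      fun x y h => pow_nonneg (ha x y h) _
  have hnum : 2 * (P.card : ℝ) ^ (q + 1) ≤ (k : ℝ) ^ (2 * (q + 1)) := by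
    have hle : 2 * (P.card : ℝ) ≤ (k : ℝ) ^ 2 := by
      exact_mod_cast two_mul_card_filter_lt_le k
    calc 2 * (P.card : ℝ) ^ (q + 1) ≤ 2 ^ (q + 1) * (P.card : ℝ) ^ (q + 1) := by
          gcongr
          exact le_self_pow₀ one_le_two q.succ_ne_zero
      _ = (2 * (P.card : ℝ)) ^ (q + 1) := (mul_pow _ _ _).symm
      _ ≤ ((k : ℝ) ^ 2) ^ (q + 1) := by gcongr
      _ = (k : ℝ) ^ (2 * (q + 1)) := (pow_mul _ _ _).symm
  calc _ ≤ ∑ τ : Fin k → Fin c, (P.card : ℝ) ^ q *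
          ∑ ij ∈ P, a (min (τ ij.1) (τ ij.2)) (max (τ ij.1) (τ ij.2)) ^ (q + 1) :=
        Finset.sum_le_sum fun τ _ => hmean τ
    _ = (P.card : ℝ) ^ q * ∑ ij ∈ P, ∑ τ : Fin k → Fin c,
          a (min (τ ij.1) (τ ij.2)) (max (τ ij.1) (τ ij.2)) ^ (q + 1) := by
        rw [← Finset.mul_sum, Finset.sum_comm]
    _ ≤ (P.card : ℝ) ^ q * ∑ ij ∈ P, (c : ℝ) ^ (k - 2) * (2 * S) := by
        gcongr with ij hij
        exact hpair ij hij
    _ = 2 * (P.card : ℝ) ^ (q + 1) * (c : ℝ) ^ (k - 2) * S := by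
        rw [Finset.sum_const, nsmul_eq_mul]
        ring
    _ ≤ (k : ℝ) ^ (2 * (q + 1)) * (c : ℝ) ^ (k - 2) * S := by gcongr
end
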